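/- arXiv:1109.0099 — 2 statements merged into one kernel-verified Lean document; each statement's English description precedes it below -/
import Mathlib

section
/- Let n ≥ 3 and let V be a nonnegative function on ℝ^n, not almost everywhere zero, belonging to the reverse Hölder class B_{n/2}. Define ρ(x) = 1/m_V(x) = sup{ r > 0 : r^{2−n} ∫_{B(x,r)} V(y) dy ≤ 1 }. Then 0 < m_V(x) < ∞ for every x, and there exist constants l_0 > 0 and C_0 > 1 such that for all x, y ∈ ℝ^n: C_0^{-1} (1 + |x−y| m_V(x))^{-l_0} ≤ m_V(x)/m_V(y) ≤ C_0 (1 + |x−y| m_V(x))^{l_0/(l_0+1)}. In particular m_V(x) ≍ m_V(y) whenever |x−y| < C/m_V(x). -/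
open MeasureTheory Metric Set
open scoped ENNReal

noncomputable section

/-- Euclidean space `ℝ^n`. -/
abbrev Euc (n : ℕ) := EuclideanSpace ℝ (Fin n)

namespace Schrodinger

variable {n : ℕ}

/-- The axis-parallel closed cube with center `x₀` and sidelength `r`. -/
def cube (x₀ : Euc n) (r : ℝ) : Set (Euc n) := {y : Euc n | ∀ i, |y i - x₀ i| ≤ r / 2}

/-- `Ψ_θ(B)` for a ball (or cube) with center `x₀` and radius (or sidelength) `r`,
i.e. `(1 + r/ρ(x₀))^θ`. -/
def psi (ρ : Euc n → ℝ) (θ : ℝ) (x₀ : Euc n) (r : ℝ) : ℝ := (1 + r / ρ x₀) ^ θ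

/-- `ρ` is a critical radius function with constants `C₀ > 1` and `l₀ > 0`. -/
def IsCriticalRadius (ρ : Euc n → ℝ) (C₀ l₀ : ℝ) : Prop :=
  1 < C₀ ∧ 0 < l₀ ∧ (∀ x, 0 < ρ x) ∧ ∀ x y : Euc n,
    C₀⁻¹ * ρ x * (1 + dist x y / ρ x) ^ (-l₀) ≤ ρ y ∧
      ρ y ≤ C₀ * ρ x * (1 + dist x y / ρ x) ^ (l₀ / (l₀ + 1))

/-- A weight: a positive locally integrable function. -/
def IsWeight (w : Euc n → ℝ) : Prop :=
  (∀ x, 0 < w x) ∧ LocallyIntegrable w volume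

/-- The class `A_1^{ρ,θ}`. -/
def MemA1 (ρ : Euc n → ℝ) (θ : ℝ) (w : Euc n → ℝ) : Prop :=
  ∃ C : ℝ, ∀ᵐ x : Euc n, ∀ (x₀ : Euc n) (r : ℝ), 0 < r → x ∈ Metric.ball x₀ r →
    (psi ρ θ x₀ r * (volume (Metric.ball x₀ r)).toReal)⁻¹ *
      (∫ y in Metric.ball x₀ r, w y) ≤ C * w x

/-- The class `A_p^{ρ,θ}` for `p > 1`. -/
def MemApGt1 (ρ : Euc n → ℝ) (θ p : ℝ) (w : Euc n → ℝ) : Prop :=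
  ∃ C : ℝ, ∀ (x₀ : Euc n) (r : ℝ), 0 < r →
    ((psi ρ θ x₀ r * (volume (Metric.ball x₀ r)).toReal)⁻¹ *
        ∫ y in Metric.ball x₀ r, w y) *
      ((psi ρ θ x₀ r * (volume (Metric.ball x₀ r)).toReal)⁻¹ *
          ∫ y in Metric.ball x₀ r, w y ^ (-(1 / (p - 1)))) ^ (p - 1) ≤ C

/-- The class `A_p^{ρ,θ}` for `p ≥ 1`. -/
def MemAp (ρ : Euc n → ℝ) (θ p : ℝ) (w : Euc n → ℝ) : Prop :=
  if p = 1 then MemA1 ρ θ w else MemApGt1 ρ θ p w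

/-- The class `A_∞^{ρ,θ} = ∪_{p ≥ 1} A_p^{ρ,θ}`. -/
def MemAInfty (ρ : Euc n → ℝ) (θ : ℝ) (w : Euc n → ℝ) : Prop :=
  ∃ p : ℝ, 1 ≤ p ∧ MemAp ρ θ p w

/-- The class `A_{(p,q)}^{ρ,θ}`. -/
def MemApq (ρ : Euc n → ℝ) (θ p q : ℝ) (w : Euc n → ℝ) : Prop :=
  if p = 1 then
    ∃ C : ℝ, ∀ (x₀ : Euc n) (r : ℝ), 0 < r →
      ((psi ρ θ x₀ r * r ^ n)⁻¹ * ∫ y in cube x₀ r, w y ^ q) ^ (1 / q) *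
        essSup (fun y => (w y)⁻¹) (volume.restrict (cube x₀ r)) ≤ C
  else
    ∃ C : ℝ, ∀ (x₀ : Euc n) (r : ℝ), 0 < r →
      ((psi ρ θ x₀ r * r ^ n)⁻¹ * ∫ y in cube x₀ r, w y ^ q) ^ (1 / q) *
        ((psi ρ θ x₀ r * r ^ n)⁻¹ *
            ∫ y in cube x₀ r, w y ^ (-(p / (p - 1)))) ^ ((p - 1) / p) ≤ C

/-- The measure `ω(E) = ∫_E ω` as a lower integral. -/
def wSet (w : Euc n → ℝ) (E : Set (Euc n)) : ℝ≥0∞ := ∫⁻ x in E, ENNReal.ofReal (w x)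

/-- The maximal operator
`M_{β,V,η} g(x) = sup_{Q ∋ x} Ψ(Q)^{-η} (Ψ(Q)|Q|)^{β/n-1} ∫_Q g`,
the supremum being over all cubes containing `x`.  Taking `β = 0`, `η = 0` gives `M_V`;
taking `η = 0` gives `M_{β,V}`. -/
def eMaxB (ρ : Euc n → ℝ) (θ β η : ℝ) (g : Euc n → ℝ≥0∞) (x : Euc n) : ℝ≥0∞ :=
  ⨆ (x₀ : Euc n) (r : ℝ) (_ : 0 < r ∧ x ∈ cube x₀ r),
    ENNReal.ofReal (psi ρ θ x₀ r ^ (-η) * (psi ρ θ x₀ r * r ^ n) ^ (β / (n : ℝ) - 1)) *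
      ∫⁻ y in cube x₀ r, g y

/-- `|f|` as an `ℝ≥0∞`-valued function. -/
def ofl (f : Euc n → ℝ) : Euc n → ℝ≥0∞ := fun y => ENNReal.ofReal |f y|

/-- The dyadic cube `2^{-k}(m + [0,1)^n)`. -/
def dyadicCube (k : ℤ) (m : Fin n → ℤ) : Set (Euc n) :=
  {y : Euc n | ∀ i, (m i : ℝ) * 2 ^ (-k) ≤ y i ∧ y i < ((m i : ℝ) + 1) * 2 ^ (-k)}

/-- The center of the dyadic cube `2^{-k}(m + [0,1)^n)`. -/
def dyadicCenter (k : ℤ) (m : Fin n → ℤ) : Euc n :=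
  (EuclideanSpace.equiv (Fin n) ℝ).symm fun i => ((m i : ℝ) + 1 / 2) * 2 ^ (-k)

/-- The sidelength of a dyadic cube of generation `k`. -/
def dSide (k : ℤ) : ℝ := 2 ^ (-k)

/-- The dyadic maximal operator `M^Δ_{V,η}`. -/
def eMD (ρ : Euc n → ℝ) (θ η : ℝ) (g : Euc n → ℝ≥0∞) (x : Euc n) : ℝ≥0∞ :=
  ⨆ (k : ℤ) (m : Fin n → ℤ) (_ : x ∈ dyadicCube k m),
    (ENNReal.ofReal (psi ρ θ (dyadicCenter k m) (dSide k) ^ η * dSide k ^ n))⁻¹ *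
      ∫⁻ y in dyadicCube k m, g y

/-- The dyadic sharp maximal operator `M^♯_{V,η}`. -/
def eMSharp (ρ : Euc n → ℝ) (θ η : ℝ) (g : Euc n → ℝ) (x : Euc n) : ℝ≥0∞ :=
  (⨆ (k : ℤ) (m : Fin n → ℤ)
      (_ : x ∈ dyadicCube k m ∧ dSide k < ρ (dyadicCenter k m)),
      (ENNReal.ofReal (dSide k ^ n))⁻¹ *
        ∫⁻ y in dyadicCube k m,
          ENNReal.ofReal |g y - (dSide k ^ n)⁻¹ * ∫ z in dyadicCube k m, g z|) +
  ⨆ (k : ℤ) (m : Fin n → ℤ)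
      (_ : x ∈ dyadicCube k m ∧ ρ (dyadicCenter k m) ≤ dSide k),
      (ENNReal.ofReal (psi ρ θ (dyadicCenter k m) (dSide k) ^ η * dSide k ^ n))⁻¹ *
        ∫⁻ y in dyadicCube k m, ENNReal.ofReal |g y|

/-- The Young function `B(t) = t log(e + t)`. -/
def youngB (t : ℝ) : ℝ := t * Real.log (Real.exp 1 + t)

/-- The Luxemburg norm `‖f‖_{B,Q}` for `B(t) = t log(e+t)`. -/
def eluxB (Q : Set (Euc n)) (f : Euc n → ℝ) : ℝ≥0∞ :=
  sInf {l : ℝ≥0∞ | 0 < l ∧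
    ∫⁻ y in Q, ENNReal.ofReal (youngB (|f y| / l.toReal)) ≤ volume Q}

/-- The Orlicz maximal operator
`M_{LlogL,β,V,η} f(x) = sup_{Q ∋ x} Ψ(Q)^{-η} (Ψ(Q)|Q|)^{β/n} ‖f‖_{B,Q}`. -/
def MLlogL (ρ : Euc n → ℝ) (θ β η : ℝ) (f : Euc n → ℝ) (x : Euc n) : ℝ≥0∞ :=
  ⨆ (x₀ : Euc n) (r : ℝ) (_ : 0 < r ∧ x ∈ cube x₀ r),
    ENNReal.ofReal (psi ρ θ x₀ r ^ (-η) * (psi ρ θ x₀ r * r ^ n) ^ (β / (n : ℝ))) *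
      eluxB (cube x₀ r) f

/-- The weighted fractional maximal operator
`M_{β,ω} f(x) = sup_{B ∋ x} ω(5B)^{β/n-1} ∫_B |f| ω` over balls. -/
def eMaxW (w : Euc n → ℝ) (β : ℝ) (f : Euc n → ℝ) (x : Euc n) : ℝ≥0∞ :=
  ⨆ (x₀ : Euc n) (r : ℝ) (_ : 0 < r ∧ x ∈ Metric.ball x₀ r),
    wSet w (Metric.ball x₀ (5 * r)) ^ (β / (n : ℝ) - 1) *
      ∫⁻ y in Metric.ball x₀ r, ENNReal.ofReal (|f y| * w y)

/-- The average of `b` over the ball `B(x₀,r)`. -/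
def ballAvg (b : Euc n → ℝ) (x₀ : Euc n) (r : ℝ) : ℝ :=
  (volume (Metric.ball x₀ r)).toReal⁻¹ * ∫ y in Metric.ball x₀ r, b y

/-- `h_φ(s) = sup_{t>0} φ(st)/φ(t)`. -/
def hGen (φ : ℝ → ℝ) (s : ℝ) : ℝ := ⨆ t : {t : ℝ // 0 < t}, φ (s * t.1) / φ t.1

/-- `Φ(s) = s / h_B(s^{β/n})` for `s > 0`, `Φ(0) = 0`, where `B(t) = t log(e+t)`. -/
def PhiB (n : ℕ) (β : ℝ) (s : ℝ) : ℝ :=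
  if 0 < s then s / hGen youngB (s ^ (β / (n : ℝ))) else 0

end Schrodinger

open Schrodinger

namespace Schrodinger

/-- The set of admissible radii in the definition of `ρ(x) = 1/m_V(x)`. -/
def rhoSet (V : Euc n → ℝ) (x : Euc n) : Set ℝ :=
  {r : ℝ | 0 < r ∧ r ^ (2 - (n : ℝ)) * ∫ y in Metric.ball x r, V y ≤ 1}

/-- `ρ(x) = sup { r > 0 : r^{2-n} ∫_{B(x,r)} V ≤ 1 }`. -/
def rhoV (V : Euc n → ℝ) (x : Euc n) : ℝ := sSup (rhoSet V x)

/-- `m_V(x) = 1/ρ(x)`. -/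
def mV (V : Euc n → ℝ) (x : Euc n) : ℝ := (rhoV V x)⁻¹

end Schrodinger


namespace Schrodinger

/-- The set of radii where `φ x` is at most `1` is nonempty and bounded above, if `φ x` has
at least power growth. -/
theorem critical_set_bounds {X : Type*} [PseudoMetricSpace X] {φ : X → ℝ → ℝ} {A δ : ℝ}
    (hA : 1 ≤ A) (hδ : 0 < δ) (hpos : ∀ x r, 0 < r → 0 < φ x r)
    (hlow : ∀ x r R, 0 < r → r ≤ R → φ x r ≤ A * (r / R) ^ δ * φ x R) (x : X) :
    {r | 0 < r ∧ φ x r ≤ 1}.Nonempty ∧ BddAbove {r | 0 < r ∧ φ x r ≤ 1} := by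
  have hA0 : 0 < A := by linarith
  have h1 := hpos x 1 one_pos
  constructor
  · set a := (A * φ x 1)⁻¹ with ha
    have ha0 : 0 < a := by positivity
    refine ⟨min 1 (a ^ δ⁻¹), by positivity, ?_⟩
    have hm : 0 < min 1 (a ^ δ⁻¹) := by positivity
    have h2 := hlow x _ 1 hm (min_le_left _ _)
    have h3 : (min 1 (a ^ δ⁻¹)) ^ δ ≤ a := by
      calc (min 1 (a ^ δ⁻¹)) ^ δ ≤ (a ^ δ⁻¹) ^ δ :=
            Real.rpow_le_rpow hm.le (min_le_right _ _) hδ.le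
        _ = a := Real.rpow_inv_rpow ha0.le hδ.ne'
    rw [div_one] at h2
    calc φ x (min 1 (a ^ δ⁻¹)) ≤ A * (min 1 (a ^ δ⁻¹)) ^ δ * φ x 1 := h2
      _ ≤ A * a * φ x 1 := by gcongr
      _ = 1 := by rw [ha]; field_simp
  · set a := A * (φ x 1)⁻¹ with ha
    have ha0 : 0 < a := by positivity
    refine ⟨max 1 (a ^ δ⁻¹), ?_⟩
    rintro r ⟨hr, hr1⟩
    rcases le_total r 1 with h | h
    · exact h.trans (le_max_left _ _)
    refine le_trans ?_ (le_max_right _ _)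
    have h2 := hlow x 1 r one_pos h
    have h3 : φ x 1 ≤ A * (1 / r) ^ δ := by
      refine h2.trans (mul_le_of_le_one_right (by positivity) hr1)
    rw [Real.div_rpow zero_le_one hr.le, Real.one_rpow] at h3
    have hrd : 0 < r ^ δ := by positivity
    have h4 : r ^ δ ≤ a := by
      rw [ha, ← div_eq_mul_inv, le_div_iff₀ h1]
      rw [mul_one_div, le_div_iff₀ hrd] at h3
      linarith
    calc r = (r ^ δ) ^ δ⁻¹ := (Real.rpow_rpow_inv hr.le hδ.ne').symm
      _ ≤ a ^ δ⁻¹ := by gcongr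

/-- Lower bound for the critical radius at `y` in terms of the one at `x`. -/
theorem critical_radius_lower {X : Type*} [PseudoMetricSpace X] {φ : X → ℝ → ℝ} {A δ k : ℝ}
    (hA : 1 ≤ A) (hδ : 0 < δ) (hk : 0 < k) (hpos : ∀ x r, 0 < r → 0 < φ x r)
    (hlow : ∀ x r R, 0 < r → r ≤ R → φ x r ≤ A * (r / R) ^ δ * φ x R)
    (hup : ∀ x r R, 0 < r → r ≤ R → φ x R ≤ A * (R / r) ^ k * φ x r)
    (hshift : ∀ x y r, 0 < r → dist x y ≤ r → φ y r ≤ A * φ x (2 * r))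
    {ρ : X → ℝ} (hρ : ∀ x, ρ x = sSup {r | 0 < r ∧ φ x r ≤ 1}) :
    (∀ x, 0 < ρ x) ∧ ∃ c : ℝ, 0 < c ∧ ∀ x y,
      c * ρ x * (1 + dist x y / ρ x) ^ (-(k / δ)) ≤ ρ y := by
  have hA0 : 0 < A := by linarith
  have hS := critical_set_bounds hA hδ hpos hlow
  have hρpos : ∀ x, 0 < ρ x := by
    intro x
    obtain ⟨r, hr⟩ := (hS x).1
    rw [hρ]
    exact hr.1.trans_le (le_csSup (hS x).2 hr)
  refine ⟨hρpos, ((A ^ 3)⁻¹ * 4 ^ (-k)) ^ δ⁻¹, by positivity, ?_⟩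
  intro x y
  have hx := hρpos x
  have hd := dist_nonneg (x := x) (y := y)
  set s := 1 + dist x y / ρ x with hs
  have hs1 : 1 ≤ s := by rw [hs]; linarith [div_nonneg hd hx.le]
  have hs0 : 0 < s := by linarith
  obtain ⟨r, ⟨hr0, hr1⟩, hr2⟩ : ∃ r ∈ {r | 0 < r ∧ φ x r ≤ 1}, ρ x / 2 < r := by
    refine exists_lt_of_lt_csSup (hS x).1 ?_
    rw [← hρ]; linarith
  have hr3 : r ≤ ρ x := by rw [hρ]; exact le_csSup (hS x).2 ⟨hr0, hr1⟩
  set T := dist x y + ρ x with hT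
  have hTs : T = ρ x * s := by rw [hT, hs]; field_simp; ring
  have hT0 : 0 < T := by linarith
  have hyT : φ y T ≤ A ^ 2 * (4 * s) ^ k := by
    calc φ y T ≤ A * φ x (2 * T) := hshift x y T hT0 (by linarith)
      _ ≤ A * (A * (2 * T / r) ^ k * φ x r) := by
        gcongr; exact hup x r (2 * T) hr0 (by linarith)
      _ ≤ A * (A * (4 * s) ^ k * 1) := by
        have h4 : 2 * T / r ≤ 4 * s := by
          rw [div_le_iff₀ hr0, hTs]
          nlinarith
        have := (hpos x r hr0).le
        gcongr
      _ = A ^ 2 * (4 * s) ^ k := by ring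
  set t := ((A ^ 3)⁻¹ * (4 * s) ^ (-k)) ^ δ⁻¹ with ht
  have hb0 : 0 < (A ^ 3)⁻¹ * (4 * s) ^ (-k) := by positivity
  have ht0 : 0 < t := by positivity
  have ht1 : t ≤ 1 := by
    refine Real.rpow_le_one hb0.le ?_ (by positivity)
    refine mul_le_one₀ (inv_le_one_of_one_le₀ (one_le_pow₀ hA)) (by positivity) ?_
    exact Real.rpow_le_one_of_one_le_of_nonpos (by linarith) (by linarith)
  have htS : t * T ∈ {r | 0 < r ∧ φ y r ≤ 1} := by
    refine ⟨by positivity, ?_⟩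
    calc φ y (t * T) ≤ A * (t * T / T) ^ δ * φ y T :=
          hlow y _ _ (by positivity) (mul_le_of_le_one_left hT0.le ht1)
      _ = A * ((A ^ 3)⁻¹ * (4 * s) ^ (-k)) * φ y T := by
        rw [mul_div_cancel_right₀ _ hT0.ne', ht, Real.rpow_inv_rpow hb0.le hδ.ne']
      _ ≤ A * ((A ^ 3)⁻¹ * (4 * s) ^ (-k)) * (A ^ 2 * (4 * s) ^ k) := by gcongr
      _ = 1 := by
        rw [Real.rpow_neg (by positivity)]
        have : 0 < (4 * s) ^ k := by positivity
        field_simp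
  have h5 : t * T ≤ ρ y := by rw [hρ y]; exact le_csSup (hS y).2 htS
  have h6 : t = ((A ^ 3)⁻¹ * 4 ^ (-k)) ^ δ⁻¹ * s ^ (-(k / δ)) := by
    rw [ht, Real.mul_rpow (by norm_num) hs0.le, ← mul_assoc,
      Real.mul_rpow (by positivity) (by positivity), ← Real.rpow_mul hs0.le]
    congr 2
    ring
  calc _ = t * ρ x := by rw [h6]; ring
    _ ≤ t * T := by gcongr; linarith
    _ ≤ ρ y := h5

/-- Interchanging the two points in a lower bound for the critical radius yields an upper bound. -/
theorem critical_radius_upper {X : Type*} [PseudoMetricSpace X] {ρ : X → ℝ} {c l : ℝ}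
    (hc : 0 < c) (hl : 0 < l) (hρ : ∀ x, 0 < ρ x)
    (h : ∀ x y, c * ρ x * (1 + dist x y / ρ x) ^ (-l) ≤ ρ y) :
    ∃ C : ℝ, 1 < C ∧ ∀ x y,
      C⁻¹ * (1 + dist x y / ρ x) ^ (-l) ≤ ρ y / ρ x ∧
      ρ y / ρ x ≤ C * (1 + dist x y / ρ x) ^ (l / (l + 1)) := by
  set K := c⁻¹ * 2 ^ l with hK
  have hK0 : 0 < K := by positivity
  refine ⟨1 + c⁻¹ + K + K ^ (l + 1)⁻¹, ?_, ?_⟩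
  · have : 0 < c⁻¹ + K + K ^ (l + 1)⁻¹ := by positivity
    linarith
  intro x y
  have hx := hρ x
  have hy := hρ y
  have hd := dist_nonneg (x := x) (y := y)
  have hKr : 0 < K ^ (l + 1)⁻¹ := by positivity
  have hci : 0 < c⁻¹ := by positivity
  constructor
  · rw [le_div_iff₀ hx]
    refine le_trans ?_ (h x y)
    have : (1 + c⁻¹ + K + K ^ (l + 1)⁻¹)⁻¹ ≤ c := by
      rw [inv_le_comm₀ (by positivity) hc]; linarith
    calc _ = (1 + c⁻¹ + K + K ^ (l + 1)⁻¹)⁻¹ * ρ x * (1 + dist x y / ρ x) ^ (-l) := by ring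
      _ ≤ _ := by gcongr
  set s := 1 + dist x y / ρ x with hs
  have hs1 : 1 ≤ s := by rw [hs]; linarith [div_nonneg hd hx.le]
  have hs0 : 0 < s := by linarith
  set a := ρ y / ρ x with ha
  have ha0 : 0 < a := by positivity
  have hsl : 1 ≤ s ^ (l / (l + 1)) := Real.one_le_rpow hs1 (by positivity)
  have h1 := h y x
  set s' := 1 + dist y x / ρ y with hs'
  have hs'0 : 0 < s' := by positivity
  have has : a * s' ≤ a + s := by
    rw [hs', hs, ha, dist_comm y x]
    field_simp
    linarith
  have h2 : a ≤ c⁻¹ * s' ^ l := by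
    rw [Real.rpow_neg hs'0.le] at h1
    rw [ha, div_le_iff₀ hx]
    have : 0 < s' ^ l := by positivity
    calc ρ y = c⁻¹ * s' ^ l * (c * ρ y * (s' ^ l)⁻¹) := by field_simp
      _ ≤ _ := by gcongr
  have h3 : a * a ^ l ≤ c⁻¹ * (a + s) ^ l := by
    calc a * a ^ l ≤ c⁻¹ * s' ^ l * a ^ l := by gcongr
      _ = c⁻¹ * (a * s') ^ l := by rw [Real.mul_rpow ha0.le hs'0.le]; ring
      _ ≤ _ := by gcongr
  rcases le_total a s with has' | has'
  · have h4 : a ^ (l + 1) ≤ K * s ^ l := by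
      rw [Real.rpow_add_one ha0.ne', mul_comm]
      calc a * a ^ l ≤ c⁻¹ * (a + s) ^ l := h3
        _ ≤ c⁻¹ * (2 * s) ^ l := by gcongr; linarith
        _ = K * s ^ l := by rw [Real.mul_rpow (by norm_num) hs0.le, hK]; ring
    have h5 : a ≤ K ^ (l + 1)⁻¹ * s ^ (l / (l + 1)) := by
      calc a = (a ^ (l + 1)) ^ (l + 1)⁻¹ := (Real.rpow_rpow_inv ha0.le (by linarith)).symm
        _ ≤ (K * s ^ l) ^ (l + 1)⁻¹ := by gcongr
        _ = _ := by
          rw [Real.mul_rpow hK0.le (by positivity), ← Real.rpow_mul hs0.le, div_eq_mul_inv]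
    refine h5.trans ?_
    gcongr
    linarith
  · have h4 : a * a ^ l ≤ K * a ^ l := by
      calc a * a ^ l ≤ c⁻¹ * (a + s) ^ l := h3
        _ ≤ c⁻¹ * (2 * a) ^ l := by gcongr; linarith
        _ = K * a ^ l := by rw [Real.mul_rpow (by norm_num) ha0.le, hK]; ring
    have h5 : a ≤ K := le_of_mul_le_mul_right h4 (by positivity)
    calc a ≤ (1 + c⁻¹ + K + K ^ (l + 1)⁻¹) * 1 := by linarith
      _ ≤ _ := by gcongr

/-- A monotone function controlled under one contraction of its argument has polynomial growth. -/
theorem exists_rpow_growth_upper {ι : Type*} {f : ι → ℝ → ℝ} {θ : ℝ} (hθ0 : 0 < θ) (hθ1 : θ < 1)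
    (hmono : ∀ x r R, 0 < r → r ≤ R → f x r ≤ f x R)
    (h : ∀ x r, 0 < r → f x r ≤ 2 * f x (θ * r)) (hf : ∀ x r, 0 < r → 0 ≤ f x r) :
    ∃ k : ℝ, 0 < k ∧ ∀ x r R, 0 < r → r ≤ R → f x R ≤ 2 * (R / r) ^ k * f x r := by
  have hk0 : 0 < Real.log 2 / Real.log θ⁻¹ :=
    div_pos (Real.log_pos (by norm_num)) (Real.log_pos (one_lt_inv₀ hθ0 |>.2 hθ1))
  refine ⟨Real.log 2 / Real.log θ⁻¹, hk0, ?_⟩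
  intro x r R hr hrR
  have hR : 0 < R := hr.trans_le hrR
  have hlog : Real.log θ⁻¹ ≠ 0 := (Real.log_pos (one_lt_inv₀ hθ0 |>.2 hθ1)).ne'
  have hk : θ⁻¹ ^ (Real.log 2 / Real.log θ⁻¹) = 2 := by
    rw [Real.rpow_def_of_pos (by positivity), mul_div_cancel₀ _ hlog, Real.exp_log (by norm_num)]
  obtain ⟨m, hm1, hm2⟩ := exists_nat_pow_near (one_le_div hr |>.2 hrR) (one_lt_inv₀ hθ0 |>.2 hθ1)
  have hiter : ∀ j : ℕ, f x R ≤ 2 ^ j * f x (θ ^ j * R) := by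
    intro j
    induction j with
    | zero => simp
    | succ j ih =>
      have := h x (θ ^ j * R) (by positivity)
      calc f x R ≤ 2 ^ j * f x (θ ^ j * R) := ih
        _ ≤ 2 ^ j * (2 * f x (θ * (θ ^ j * R))) := by gcongr
        _ = _ := by ring_nf
  have h1 : θ ^ (m + 1) * R ≤ r := by
    rw [inv_pow, div_lt_iff₀ hr, inv_mul_eq_div, lt_div_iff₀ (by positivity)] at hm2
    linarith
  calc f x R ≤ 2 ^ (m + 1) * f x (θ ^ (m + 1) * R) := hiter _
    _ ≤ 2 ^ (m + 1) * f x r := by gcongr; exact hmono _ _ _ (by positivity) h1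
    _ ≤ 2 * (R / r) ^ (Real.log 2 / Real.log θ⁻¹) * f x r := by
      have : (2 : ℝ) ^ m ≤ (R / r) ^ (Real.log 2 / Real.log θ⁻¹) := by
        calc (2 : ℝ) ^ m = (θ⁻¹ ^ m) ^ (Real.log 2 / Real.log θ⁻¹) := by
              rw [← Real.rpow_pow_comm (by positivity), hk]
          _ ≤ _ := by gcongr
      have h0 := hf x r hr
      rw [pow_succ']
      gcongr

/-- A monotone function that grows by a fixed factor when its argument doubles has at least
power growth. -/
theorem exists_rpow_growth_lower {ι : Type*} {f : ι → ℝ → ℝ} {q : ℝ} (hq : 1 < q)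
    (hmono : ∀ x r R, 0 < r → r ≤ R → f x r ≤ f x R)
    (h : ∀ x r, 0 < r → q * f x r ≤ f x (2 * r)) (hf : ∀ x r, 0 < r → 0 ≤ f x r) :
    ∃ δ : ℝ, 0 < δ ∧ ∀ x r R, 0 < r → r ≤ R → f x r ≤ q * (r / R) ^ δ * f x R := by
  have hq0 : 0 < q := by linarith
  have hl2 : 0 < Real.log 2 := Real.log_pos (by norm_num)
  set δ := Real.log q / Real.log 2 with hδ
  have hδ0 : 0 < δ := div_pos (Real.log_pos hq) hl2
  refine ⟨δ, hδ0, ?_⟩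
  intro x r R hr hrR
  have hR : 0 < R := hr.trans_le hrR
  have hk : (2 : ℝ) ^ δ = q := by
    rw [Real.rpow_def_of_pos (by norm_num), hδ, mul_div_cancel₀ _ hl2.ne', Real.exp_log hq0]
  obtain ⟨m, hm1, hm2⟩ := exists_nat_pow_near (one_le_div hr |>.2 hrR) (one_lt_two (α := ℝ))
  have hiter : ∀ j : ℕ, q ^ j * f x r ≤ f x (2 ^ j * r) := by
    intro j
    induction j with
    | zero => simp
    | succ j ih =>
      calc q ^ (j + 1) * f x r = q * (q ^ j * f x r) := by ring
        _ ≤ q * f x (2 ^ j * r) := by gcongr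
        _ ≤ f x (2 * (2 ^ j * r)) := h _ _ (by positivity)
        _ = _ := by ring_nf
  have h1 : q ^ m * f x r ≤ f x R :=
    (hiter m).trans (hmono _ _ _ (by positivity) (by rwa [le_div_iff₀ hr] at hm1))
  have h2 : (R / r) ^ δ ≤ q ^ (m + 1) := by
    calc (R / r) ^ δ ≤ ((2 : ℝ) ^ (m + 1)) ^ δ := by gcongr
      _ = q ^ (m + 1) := by
        rw [← Real.rpow_pow_comm (by norm_num), hk]
  have hp : 0 < (R / r) ^ δ := by positivity
  have h0 := hf x r hr
  have h3 : (R / r) ^ δ * f x r ≤ q * f x R := by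
    calc (R / r) ^ δ * f x r ≤ q ^ (m + 1) * f x r := by gcongr
      _ = q * (q ^ m * f x r) := by ring
      _ ≤ _ := by gcongr
  rw [← inv_div R r, Real.inv_rpow (by positivity)]
  calc f x r = ((R / r) ^ δ)⁻¹ * ((R / r) ^ δ * f x r) := by field_simp
    _ ≤ ((R / r) ^ δ)⁻¹ * (q * f x R) := by gcongr
    _ = _ := by ring

/-- Hölder's inequality against the constant function `1` on a finite measure space. -/
theorem integrable_and_integral_le_rpow {α : Type*} [MeasurableSpace α] {μ : Measure α}
    [IsFiniteMeasure μ] {f : α → ℝ} (hf : ∀ x, 0 ≤ f x) {p : ℝ} (hp : 1 < p)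
    (hint : Integrable (fun x => f x ^ p) μ) :
    Integrable f μ ∧
      ∫ x, f x ∂μ ≤ (∫ x, f x ^ p ∂μ) ^ (1 / p) * (μ univ).toReal ^ (1 - 1 / p) := by
  have hp0 : 0 < p := by linarith
  have hmeas : AEStronglyMeasurable f μ := by
    have h1 : f = fun x => (f x ^ p) ^ p⁻¹ := by
      funext x
      exact (Real.rpow_rpow_inv (hf x) hp0.ne').symm
    rw [h1]
    exact (hint.aestronglyMeasurable.aemeasurable.pow_const _).aestronglyMeasurable
  have hLp : MemLp f (ENNReal.ofReal p) μ := by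
    rw [← integrable_norm_rpow_iff hmeas (by simpa using hp0) ENNReal.ofReal_ne_top,
      ENNReal.toReal_ofReal hp0.le]
    simpa only [Real.norm_of_nonneg (hf _)] using hint
  refine ⟨hLp.integrable (by simpa using hp.le), ?_⟩
  have hc := Real.HolderConjugate.conjExponent hp
  have h := integral_mul_le_Lp_mul_Lq_of_nonneg (μ := μ) (g := fun _ => (1 : ℝ)) hc
    (Filter.Eventually.of_forall hf) (Filter.Eventually.of_forall fun _ => zero_le_one) hLp
    (memLp_const 1)
  have he : 1 / p.conjExponent = 1 - 1 / p := by
    rw [one_div, one_div]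
    linarith [hc.inv_add_inv_eq_one]
  rw [he] at h
  simpa [Measure.real] using h

theorem volume_ball_toReal {n : ℕ} (hn : 0 < n) (x : Euc n) {r : ℝ} (hr : 0 < r) :
    (volume (ball x r)).toReal = r ^ n * (volume (ball (0 : Euc n) 1)).toReal := by
  have : Nonempty (Fin n) := ⟨⟨0, hn⟩⟩
  rw [Measure.addHaar_ball volume x hr.le, ENNReal.toReal_mul,
    ENNReal.toReal_ofReal (by positivity), finrank_euclideanSpace_fin]

theorem volume_unit_ball_toReal_pos (n : ℕ) : 0 < (volume (ball (0 : Euc n) 1)).toReal :=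
  ENNReal.toReal_pos (measure_ball_pos _ _ one_pos).ne' measure_ball_lt_top.ne

/-- A locally finite measure with density that is doubling on concentric balls is
reverse doubling. -/
theorem exists_reverse_doubling {n : ℕ} (hn : 0 < n) {U : Euc n → ℝ} (hU : ∀ x, 0 ≤ U x)
    (hint : ∀ x r, 0 < r → IntegrableOn U (ball x r) volume) {D : ℝ} (hD : 0 < D)
    (hdbl : ∀ x r, 0 < r → ∫ y in ball x (8 * r), U y ≤ D * ∫ y in ball x r, U y) :
    ∃ q : ℝ, 1 < q ∧ ∀ x r, 0 < r → q * ∫ y in ball x r, U y ≤ ∫ y in ball x (2 * r), U y := by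
  have : Nonempty (Fin n) := ⟨⟨0, hn⟩⟩
  refine ⟨1 + D⁻¹, by linarith [inv_pos.2 hD], ?_⟩
  intro x r hr
  obtain ⟨e, he⟩ := exists_norm_eq (Euc n) (c := 3 * r / 2) (by positivity)
  set z := x + e with hz
  have hxz : dist x z = 3 * r / 2 := by rw [hz, dist_self_add_right, he]
  have hmono : ∀ s t : Set (Euc n), IntegrableOn U t volume → s ⊆ t →
      ∫ y in s, U y ≤ ∫ y in t, U y := fun s t ht hst =>
    setIntegral_mono_set ht (Filter.Eventually.of_forall hU) hst.eventuallyLE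
  have h1 : ball x r ⊆ ball z (8 * (r / 2)) := ball_subset_ball' (by linarith)
  have h2 : ball x r ∪ ball z (r / 2) ⊆ ball x (2 * r) :=
    union_subset (ball_subset_ball (by linarith))
      (ball_subset_ball' (by rw [dist_comm, hxz]; linarith))
  have h3 : Disjoint (ball x r) (ball z (r / 2)) := ball_disjoint_ball (by linarith)
  have h4 := hmono _ _ (hint x (2 * r) (by positivity)) h2
  rw [setIntegral_union h3 measurableSet_ball (hint x r hr) (hint z _ (by positivity))] at h4
  have h5 := (hmono _ _ (hint z (8 * (r / 2)) (by positivity)) h1).trans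
    (hdbl z (r / 2) (by positivity))
  rw [← inv_mul_le_iff₀ hD] at h5
  linarith

/-- Under the reverse Hölder inequality, a fixed proportion of the mass of a ball lies in a
slightly smaller concentric ball. -/
theorem exists_concentric_half_mass {n : ℕ} (hn : 0 < n) {V : Euc n → ℝ} (hV0 : ∀ x, 0 ≤ V x)
    {p C : ℝ} (hp : 1 < p) (hC : 0 < C)
    (hVloc : ∀ x r, 0 < r → IntegrableOn (fun y => V y ^ p) (ball x r) volume)
    (hRH : ∀ x r, 0 < r → (∫ y in ball x r, V y ^ p) ^ (1 / p) ≤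
      C * (volume (ball x r)).toReal ^ (1 / p - 1) * ∫ y in ball x r, V y) :
    ∃ θ : ℝ, 0 < θ ∧ θ < 1 ∧ ∀ x r, 0 < r →
      ∫ y in ball x r, V y ≤ 2 * ∫ y in ball x (θ * r), V y := by
  have hp0 : 0 < p := by linarith
  have hp1 : 0 < 1 - 1 / p := by
    have : 1 / p < 1 := by rw [div_lt_one hp0]; exact hp
    linarith
  obtain ⟨θ, ⟨hθ0, hθ1⟩, hθ⟩ : ∃ θ ∈ Ioo (0 : ℝ) 1, C * (1 - θ ^ n) ^ (1 - 1 / p) < 1 / 2 := by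
    have hcont : Continuous fun θ : ℝ => C * (1 - θ ^ n) ^ (1 - 1 / p) := by
      refine continuous_const.mul (Continuous.rpow_const (by fun_prop) fun _ => Or.inr hp1.le)
    have h1 : ∀ᶠ θ in nhdsWithin (1 : ℝ) (Iio 1), C * (1 - θ ^ n) ^ (1 - 1 / p) < 1 / 2 := by
      refine (hcont.continuousAt.eventually_lt continuousAt_const ?_).filter_mono
        nhdsWithin_le_nhds
      simp only [one_pow, sub_self, Real.zero_rpow hp1.ne', mul_zero]
      norm_num
    have h2 : ∀ᶠ θ in nhdsWithin (1 : ℝ) (Iio 1), θ ∈ Ioo (0 : ℝ) 1 :=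
      Ioo_mem_nhdsLT zero_lt_one
    obtain ⟨θ, h⟩ := (h2.and h1).exists
    exact ⟨θ, h⟩
  refine ⟨θ, hθ0, hθ1, ?_⟩
  intro x r hr
  have hθr : 0 < θ * r := by positivity
  set B := ball x r
  set B' := ball x (θ * r)
  have hsub : B' ⊆ B := ball_subset_ball (mul_le_of_le_one_left hr.le hθ1.le)
  have hBpos : 0 < (volume B).toReal :=
    ENNReal.toReal_pos (measure_ball_pos _ _ hr).ne' measure_ball_lt_top.ne
  have hvolE : (volume (B \ B')).toReal = (1 - θ ^ n) * (volume B).toReal := by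
    rw [measure_sdiff hsub measurableSet_ball.nullMeasurableSet measure_ball_lt_top.ne,
      ENNReal.toReal_sub_of_le (measure_mono hsub) measure_ball_lt_top.ne,
      volume_ball_toReal hn x hθr, volume_ball_toReal hn x hr]
    ring
  have hfin : ∀ s ⊆ B, IsFiniteMeasure (volume.restrict s) := fun s hs =>
    ⟨by rw [Measure.restrict_apply_univ]; exact (measure_mono hs).trans_lt measure_ball_lt_top⟩
  have := hfin _ subset_rfl
  have := hfin (B \ B') sdiff_subset
  have hVint : IntegrableOn V B volume :=
    (integrable_and_integral_le_rpow hV0 hp (hVloc x r hr)).1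
  have hE := (integrable_and_integral_le_rpow (μ := volume.restrict (B \ B')) hV0 hp
    ((hVloc x r hr).mono_set sdiff_subset)).2
  rw [Measure.restrict_apply_univ, hvolE] at hE
  have hVp : ∀ y, 0 ≤ V y ^ p := fun y => Real.rpow_nonneg (hV0 y) _
  have hθn : 0 ≤ 1 - θ ^ n := by linarith [pow_le_one₀ hθ0.le hθ1.le (n := n)]
  have hv0 : 0 ≤ ∫ y in B, V y := integral_nonneg hV0
  have hE2 : ∫ y in B \ B', V y ≤ 1 / 2 * ∫ y in B, V y := by
    calc ∫ y in B \ B', V y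
        ≤ (∫ y in B \ B', V y ^ p) ^ (1 / p) *
            ((1 - θ ^ n) * (volume B).toReal) ^ (1 - 1 / p) := hE
      _ ≤ (∫ y in B, V y ^ p) ^ (1 / p) *
            ((1 - θ ^ n) * (volume B).toReal) ^ (1 - 1 / p) := by
        have hmono : ∫ y in B \ B', V y ^ p ≤ ∫ y in B, V y ^ p :=
          setIntegral_mono_set (hVloc x r hr) (Filter.Eventually.of_forall hVp)
            sdiff_subset.eventuallyLE
        have h0 : 0 ≤ ∫ y in B \ B', V y ^ p := integral_nonneg hVp
        have h1 : 0 ≤ 1 / p := by positivity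
        have h2 : 0 ≤ (1 - θ ^ n) * (volume B).toReal := by positivity
        exact mul_le_mul_of_nonneg_right (Real.rpow_le_rpow h0 hmono h1)
          (Real.rpow_nonneg h2 _)
      _ ≤ (C * (volume B).toReal ^ (1 / p - 1) * ∫ y in B, V y) *
            ((1 - θ ^ n) * (volume B).toReal) ^ (1 - 1 / p) := by
        gcongr
        exact hRH x r hr
      _ = C * (1 - θ ^ n) ^ (1 - 1 / p) * ∫ y in B, V y := by
        rw [Real.mul_rpow hθn hBpos.le, ← neg_sub, Real.rpow_neg hBpos.le]
        have : 0 < (volume B).toReal ^ (1 - 1 / p) := by positivity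
        field_simp
      _ ≤ _ := by gcongr
  have hsplit := setIntegral_union (μ := volume) (f := V)
    (disjoint_sdiff_right (s := B') (t := B)) (measurableSet_ball.diff measurableSet_ball)
    (hVint.mono_set hsub) (hVint.mono_set sdiff_subset)
  rw [union_sdiff_cancel hsub] at hsplit
  linarith

/-- A nonnegative doubling density that is not a.e. zero charges every ball. -/
theorem integral_ball_pos {n : ℕ} {V : Euc n → ℝ} (hV0 : ∀ x, 0 ≤ V x)
    (hVne : ¬ (V =ᵐ[volume] (0 : Euc n → ℝ)))
    (hint : ∀ x r, 0 < r → IntegrableOn V (ball x r) volume) {k : ℝ}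
    (hdbl : ∀ x r R, 0 < r → r ≤ R →
      ∫ y in ball x R, V y ≤ 2 * (R / r) ^ k * ∫ y in ball x r, V y)
    (x : Euc n) {r : ℝ} (hr : 0 < r) : 0 < ∫ y in ball x r, V y := by
  by_contra hcon
  have h0 : ∫ y in ball x r, V y = 0 := le_antisymm (not_lt.1 hcon) (integral_nonneg hV0)
  have hzero : ∀ R, 0 < R → ∫ y in ball x R, V y = 0 := by
    intro R hR
    refine le_antisymm ?_ (integral_nonneg hV0)
    have h1 : ∫ y in ball x R, V y ≤ ∫ y in ball x (max r R), V y :=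
      setIntegral_mono_set (hint x _ (by positivity)) (Filter.Eventually.of_forall hV0)
        (ball_subset_ball (le_max_right _ _)).eventuallyLE
    have h2 := hdbl x r (max r R) hr (le_max_left _ _)
    rw [h0, mul_zero] at h2
    exact h1.trans h2
  apply hVne
  rw [← Measure.restrict_univ (μ := volume (α := Euc n)), ← iUnion_ball_nat_succ x]
  rw [Filter.EventuallyEq, ae_restrict_iUnion_iff]
  intro m
  have hm : (0 : ℝ) < m + 1 := by positivity
  exact (setIntegral_eq_zero_iff_of_nonneg_ae (Filter.Eventually.of_forall hV0)
    (hint x _ hm)).1 (hzero _ hm)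

/-- Two-sided power growth of the scaled mass `r ^ (2 - n) * ∫ V` over `B(x, r)` for `V` in the
reverse Hölder class with exponent `n / 2`. -/
theorem exists_scaled_mass_growth {n : ℕ} (hn : 3 ≤ n) {V : Euc n → ℝ} (hV0 : ∀ x, 0 ≤ V x)
    (hVne : ¬ (V =ᵐ[volume] (0 : Euc n → ℝ)))
    (hVloc : ∀ (x : Euc n) (r : ℝ), 0 < r →
      IntegrableOn (fun y => V y ^ ((n : ℝ) / 2)) (ball x r) volume)
    {C : ℝ} (hC : 0 < C)
    (hRH : ∀ (x : Euc n) (r : ℝ), 0 < r →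
      ((volume (ball x r)).toReal⁻¹ * ∫ y in ball x r, V y ^ ((n : ℝ) / 2)) ^ ((2 : ℝ) / n) ≤
        C * ((volume (ball x r)).toReal⁻¹ * ∫ y in ball x r, V y))
    {φ : Euc n → ℝ → ℝ} (hφ : ∀ x r, φ x r = r ^ (2 - (n : ℝ)) * ∫ y in ball x r, V y) :
    ∃ A δ k : ℝ, 1 ≤ A ∧ 0 < δ ∧ 0 < k ∧ (∀ x r, 0 < r → 0 < φ x r) ∧
      (∀ x r R, 0 < r → r ≤ R → φ x r ≤ A * (r / R) ^ δ * φ x R) ∧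
      (∀ x r R, 0 < r → r ≤ R → φ x R ≤ A * (R / r) ^ k * φ x r) ∧
      (∀ x y r, 0 < r → dist x y ≤ r → φ y r ≤ A * φ x (2 * r)) := by
  have hn0 : 0 < n := by omega
  have hn3 : (3 : ℝ) ≤ n := by exact_mod_cast hn
  set p : ℝ := (n : ℝ) / 2 with hpdef
  have hp : 1 < p := by rw [hpdef]; linarith
  have hp0 : 0 < p := by linarith
  have hpn : (2 : ℝ) / n = 1 / p := by rw [hpdef, one_div_div]
  rw [hpn] at hRH
  have hvolpos : ∀ (x : Euc n) r, 0 < r → 0 < (volume (ball x r)).toReal := fun x r hr =>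
    ENNReal.toReal_pos (measure_ball_pos _ _ hr).ne' measure_ball_lt_top.ne
  have hVp : ∀ y, 0 ≤ V y ^ p := fun y => Real.rpow_nonneg (hV0 y) _
  have hRH' : ∀ x r, 0 < r → (∫ y in ball x r, V y ^ p) ^ (1 / p) ≤
      C * (volume (ball x r)).toReal ^ (1 / p - 1) * ∫ y in ball x r, V y := by
    intro x r hr
    have hb := hvolpos x r hr
    have h := hRH x r hr
    rw [Real.mul_rpow (by positivity) (integral_nonneg hVp), Real.inv_rpow hb.le,
      inv_mul_le_iff₀ (by positivity)] at h
    refine h.trans_eq ?_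
    rw [Real.rpow_sub_one hb.ne']
    ring
  have hholder : ∀ x r, 0 < r → IntegrableOn V (ball x r) volume ∧
      ∫ y in ball x r, V y ≤
        (∫ y in ball x r, V y ^ p) ^ (1 / p) * (volume (ball x r)).toReal ^ (1 - 1 / p) := by
    intro x r hr
    have : IsFiniteMeasure (volume.restrict (ball x r)) :=
      ⟨by rw [Measure.restrict_apply_univ]; exact measure_ball_lt_top⟩
    have h := integrable_and_integral_le_rpow hV0 hp (hVloc x r hr)
    rwa [Measure.restrict_apply_univ] at h
  have hint := fun x r hr => (hholder x r hr).1
  have hvmono : ∀ (x y : Euc n) r R, 0 < R → ball x r ⊆ ball y R →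
      ∫ z in ball x r, V z ≤ ∫ z in ball y R, V z := fun x y r R hR h =>
    setIntegral_mono_set (hint y R hR) (Filter.Eventually.of_forall hV0) h.eventuallyLE
  obtain ⟨θ, hθ0, hθ1, hθ⟩ := exists_concentric_half_mass hn0 hV0 hp hC hVloc hRH'
  obtain ⟨k, hk, hgrow⟩ := exists_rpow_growth_upper
    (f := fun x r => ∫ y in ball x r, V y) hθ0 hθ1
    (fun x r R hr hR => hvmono x x r R (hr.trans_le hR) (ball_subset_ball hR)) hθ
    (fun x r _ => integral_nonneg hV0)
  have hvpos := fun x r hr => integral_ball_pos hV0 hVne hint hgrow x (r := r) hr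
  have hφpos : ∀ x r, 0 < r → 0 < φ x r := by
    intro x r hr
    rw [hφ]
    have := hvpos x r hr
    positivity
  have hup : ∀ x r R, 0 < r → r ≤ R → φ x R ≤ 2 * (R / r) ^ k * φ x r := by
    intro x r R hr hR
    have hR0 : 0 < R := hr.trans_le hR
    have h1 : R ^ (2 - (n : ℝ)) ≤ r ^ (2 - (n : ℝ)) :=
      Real.rpow_le_rpow_of_nonpos hr hR (by linarith)
    have h2 := hvpos x R hR0
    rw [hφ, hφ]
    calc _ ≤ r ^ (2 - (n : ℝ)) * (2 * (R / r) ^ k * ∫ y in ball x r, V y) := by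
          gcongr; exact hgrow x r R hr hR
      _ = _ := by ring
  set w : ℝ := (volume (ball (0 : Euc n) 1)).toReal ^ (1 - 1 / p) with hw
  have hω := volume_unit_ball_toReal_pos n
  have hw0 : 0 < w := by positivity
  have hvol : ∀ (x : Euc n) r, 0 < r →
      (volume (ball x r)).toReal ^ (1 - 1 / p) = w * (r ^ (2 - (n : ℝ)))⁻¹ := by
    intro x r hr
    rw [volume_ball_toReal hn0 x hr, Real.mul_rpow (by positivity) hω.le, ← Real.rpow_neg hr.le,
      ← Real.rpow_natCast r n, ← Real.rpow_mul hr.le, mul_comm]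
    congr 2
    rw [← hpn]
    field_simp
    ring
  have hφu : ∀ x r, 0 < r → φ x r ≤ w * (∫ y in ball x r, V y ^ p) ^ (1 / p) := by
    intro x r hr
    have h := (hholder x r hr).2
    have hrp : 0 < r ^ (2 - (n : ℝ)) := by positivity
    rw [hvol x r hr] at h
    rw [hφ]
    calc _ ≤ r ^ (2 - (n : ℝ)) * ((∫ y in ball x r, V y ^ p) ^ (1 / p) *
          (w * (r ^ (2 - (n : ℝ)))⁻¹)) := by gcongr
      _ = _ := by field_simp
  have huφ : ∀ x r, 0 < r → w * (∫ y in ball x r, V y ^ p) ^ (1 / p) ≤ C * φ x r := by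
    intro x r hr
    have h := hRH' x r hr
    have hrp : 0 < r ^ (2 - (n : ℝ)) := by positivity
    rw [← neg_sub, Real.rpow_neg (hvolpos x r hr).le, hvol x r hr] at h
    rw [hφ]
    calc _ ≤ w * (C * (w * (r ^ (2 - (n : ℝ)))⁻¹)⁻¹ * ∫ y in ball x r, V y) := by gcongr
      _ = _ := by field_simp
  have hu0 : ∀ x r, 0 ≤ ∫ y in ball x r, V y ^ p := fun x r => integral_nonneg hVp
  have hudbl : ∀ x r, 0 < r → ∫ y in ball x (8 * r), V y ^ p ≤
      (C * (2 * 8 ^ k)) ^ p * ∫ y in ball x r, V y ^ p := by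
    intro x r hr
    have h := hup x r (8 * r) hr (by linarith)
    rw [mul_div_cancel_right₀ _ hr.ne'] at h
    have h1 : (∫ y in ball x (8 * r), V y ^ p) ^ (1 / p) ≤
        C * (2 * 8 ^ k) * (∫ y in ball x r, V y ^ p) ^ (1 / p) := by
      refine le_of_mul_le_mul_left ?_ hw0
      calc _ ≤ C * φ x (8 * r) := huφ x _ (by positivity)
        _ ≤ C * (2 * 8 ^ k * φ x r) := by gcongr
        _ ≤ C * (2 * 8 ^ k * (w * (∫ y in ball x r, V y ^ p) ^ (1 / p))) := by
          gcongr; exact hφu x r hr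
        _ = _ := by ring
    have h2 := Real.rpow_le_rpow (Real.rpow_nonneg (hu0 _ _) _) h1 hp0.le
    rwa [Real.mul_rpow (by positivity) (Real.rpow_nonneg (hu0 _ _) _), one_div,
      Real.rpow_inv_rpow (hu0 _ _) hp0.ne', Real.rpow_inv_rpow (hu0 _ _) hp0.ne'] at h2
  obtain ⟨q, hq, hrev⟩ := exists_reverse_doubling hn0 hVp hVloc (by positivity) hudbl
  obtain ⟨δ, hδ, hdecay⟩ := exists_rpow_growth_lower
    (f := fun x r => ∫ y in ball x r, V y ^ p) hq
    (fun x r R hr hR => setIntegral_mono_set (hVloc x R (hr.trans_le hR))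
      (Filter.Eventually.of_forall hVp) (ball_subset_ball hR).eventuallyLE) hrev
    (fun x r _ => hu0 x r)
  have hq0 : 0 < q := by linarith
  have hlow : ∀ x r R, 0 < r → r ≤ R →
      φ x r ≤ q ^ (1 / p) * C * (r / R) ^ (δ * (1 / p)) * φ x R := by
    intro x r R hr hR
    have hR0 : 0 < R := hr.trans_le hR
    have hrR : 0 < r / R := by positivity
    have h1p : 0 ≤ 1 / p := by positivity
    calc φ x r ≤ w * (∫ y in ball x r, V y ^ p) ^ (1 / p) := hφu x r hr
      _ ≤ w * (q * (r / R) ^ δ * ∫ y in ball x R, V y ^ p) ^ (1 / p) :=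
        mul_le_mul_of_nonneg_left
          (Real.rpow_le_rpow (hu0 _ _) (hdecay x r R hr hR) h1p) hw0.le
      _ = q ^ (1 / p) * (r / R) ^ (δ * (1 / p)) *
          (w * (∫ y in ball x R, V y ^ p) ^ (1 / p)) := by
        rw [Real.mul_rpow (by positivity) (hu0 _ _), Real.mul_rpow hq0.le (by positivity),
          Real.rpow_mul hrR.le]
        ring
      _ ≤ q ^ (1 / p) * (r / R) ^ (δ * (1 / p)) * (C * φ x R) := by
        exact mul_le_mul_of_nonneg_left (huφ x R hR0) (by positivity)
      _ = _ := by ring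
  have hqC : 0 < q ^ (1 / p) * C := by positivity
  have h2n : (0 : ℝ) < (2 ^ (2 - (n : ℝ)))⁻¹ := by positivity
  refine ⟨2 + q ^ (1 / p) * C + (2 ^ (2 - (n : ℝ)))⁻¹, δ * (1 / p), k, by linarith,
    by positivity, hk, hφpos, ?_, ?_, ?_⟩
  · intro x r R hr hR
    have hR0 : 0 < R := hr.trans_le hR
    have := hφpos x R hR0
    refine (hlow x r R hr hR).trans ?_
    gcongr
    linarith
  · intro x r R hr hR
    have hR0 : 0 < R := hr.trans_le hR
    have := hφpos x r hr
    refine (hup x r R hr hR).trans ?_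
    gcongr
    linarith
  · intro x y r hr hxy
    have h2r : 0 < 2 * r := by positivity
    have hpos2 := hφpos x (2 * r) h2r
    have hrp : 0 < r ^ (2 - (n : ℝ)) := by positivity
    have hsub : ball y r ⊆ ball x (2 * r) := ball_subset_ball' (by rw [dist_comm]; linarith)
    calc φ y r ≤ r ^ (2 - (n : ℝ)) * ∫ z in ball x (2 * r), V z := by
          rw [hφ]; exact mul_le_mul_of_nonneg_left (hvmono _ _ _ _ h2r hsub) hrp.le
      _ = (2 ^ (2 - (n : ℝ)))⁻¹ * φ x (2 * r) := by
        rw [hφ, Real.mul_rpow (by norm_num) hr.le]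
        field_simp
      _ ≤ _ := by gcongr; linarith

end Schrodinger

/-- Lemma 2.1, after Shen. -/
theorem stmt0 (n : ℕ) (hn : 3 ≤ n) (V : Euc n → ℝ) (hV0 : ∀ x, 0 ≤ V x)
    (hVne : ¬ (V =ᵐ[volume] (0 : Euc n → ℝ)))
    (hVloc : ∀ (x : Euc n) (r : ℝ), 0 < r →
      IntegrableOn (fun y => V y ^ ((n : ℝ) / 2)) (Metric.ball x r) volume)
    (hRH : ∃ C : ℝ, 0 < C ∧ ∀ (x : Euc n) (r : ℝ), 0 < r →
      ((volume (Metric.ball x r)).toReal⁻¹ *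
          ∫ y in Metric.ball x r, V y ^ ((n : ℝ) / 2)) ^ ((2 : ℝ) / n) ≤
        C * ((volume (Metric.ball x r)).toReal⁻¹ * ∫ y in Metric.ball x r, V y)) :
    (∀ x : Euc n, 0 < rhoV V x ∧ BddAbove (rhoSet V x)) ∧
    (∃ l₀ C₀ : ℝ, 0 < l₀ ∧ 1 < C₀ ∧ (∀ x y : Euc n,
      C₀⁻¹ * (1 + dist x y * mV V x) ^ (-l₀) ≤ mV V x / mV V y ∧
        mV V x / mV V y ≤ C₀ * (1 + dist x y * mV V x) ^ (l₀ / (l₀ + 1)))) ∧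
    (∀ C : ℝ, 0 < C → ∃ c : ℝ, 1 < c ∧ ∀ x y : Euc n,
      dist x y < C / mV V x → mV V x ≤ c * mV V y ∧ mV V y ≤ c * mV V x) := by
  obtain ⟨C, hC, hRH⟩ := hRH
  obtain ⟨A, δ, k, hA, hδ, hk, hpos, hlow, hup, hshift⟩ :=
    exists_scaled_mass_growth hn hV0 hVne hVloc hC hRH
      (φ := fun x r => r ^ (2 - (n : ℝ)) * ∫ y in Metric.ball x r, V y) (fun _ _ => rfl)
  obtain ⟨hρ, c, hc, hlower⟩ := critical_radius_lower (ρ := rhoV V) hA hδ hk hpos hlow hup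
    hshift (fun _ => rfl)
  have hl : 0 < k / δ := div_pos hk hδ
  obtain ⟨K, hK, hbounds⟩ := critical_radius_upper hc hl hρ hlower
  have hmdiv : ∀ x y, mV V x / mV V y = rhoV V y / rhoV V x := fun x y => by
    rw [mV, mV, inv_div_inv]
  refine ⟨fun x => ⟨hρ x, (critical_set_bounds hA hδ hpos hlow x).2⟩,
    ⟨k / δ, K, hl, hK, fun x y => ?_⟩, fun D hD => ?_⟩
  · rw [hmdiv, mV, ← div_eq_mul_inv]
    exact hbounds x y
  set a := K * (1 + D) ^ (k / δ / (k / δ + 1)) with ha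
  set b := K * (1 + D) ^ (k / δ) with hb
  have hK0 : 0 < K := by linarith
  have ha0 : 0 < a := by positivity
  have hb0 : 0 < b := by positivity
  refine ⟨1 + a + b, by linarith, fun x y hxy => ?_⟩
  have hm : ∀ x, 0 < mV V x := fun x => inv_pos.2 (hρ x)
  have hs : 1 + dist x y / rhoV V x ≤ 1 + D := by
    rw [mV, div_inv_eq_mul] at hxy
    have := (div_lt_iff₀ (hρ x)).2 hxy
    linarith
  have hs0 : 0 < 1 + dist x y / rhoV V x := by
    have := hρ x
    positivity
  obtain ⟨h1, h2⟩ := hbounds x y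
  rw [← hmdiv] at h1 h2
  have hmx := hm x
  have hmy := hm y
  constructor
  · rw [div_le_iff₀ hmy] at h2
    refine h2.trans ?_
    have : K * (1 + dist x y / rhoV V x) ^ (k / δ / (k / δ + 1)) ≤ a := by
      rw [ha]; gcongr
    gcongr
    linarith
  · rw [le_div_iff₀ hmy, Real.rpow_neg hs0.le, ← mul_inv, inv_mul_le_iff₀ (by positivity)] at h1
    refine h1.trans ?_
    have : K * (1 + dist x y / rhoV V x) ^ (k / δ) ≤ b := by
      rw [hb]; gcongr
    gcongr
    linarith
end
end

section
/- Let 0 ≤ β < n, 1 ≤ p < n/β (with n/β interpreted as ∞ when β = 0), 1/q = 1/p − β/n, and let ω be a weight on ℝ^n. Define M_{β,ω} f(x) = sup_{B ∋ x} ω(5B)^{β/n − 1} ∫_B |f(y)| ω(y) dy, the supremum over balls B containing x. Then there is a constant C such that ω({ x ∈ ℝ^n : M_{β,ω} f(x) > λ }) ≤ C ( ‖f‖_{L^p(ω)} / λ )^q for all λ > 0 and all f ∈ L^p(ω). Moreover, for 1 < p < n/β, ‖M_{β,ω} f‖_{L^q(ω)} ≤ C ‖f‖_{L^p(ω)}.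 -/
open MeasureTheory Metric Set
open scoped ENNReal

noncomputable section

open Schrodinger

section FractionalMaximal

variable {X : Type*} [PseudoMetricSpace X] [MeasurableSpace X]

/-- The fractional maximal function
`x ↦ sup_{B ∋ x} μ(5B)^{α-1} ∫_B g ∂μ` of a measure `μ` on a metric space. -/
def fracMax (μ : Measure X) (α : ℝ) (g : X → ℝ≥0∞) (x : X) : ℝ≥0∞ :=
  ⨆ (c : X) (r : ℝ) (_ : 0 < r ∧ x ∈ ball c r),
    μ (ball c (5 * r)) ^ (α - 1) * ∫⁻ y in ball c r, g y ∂μ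

variable {μ : Measure X} {α : ℝ} {g : X → ℝ≥0∞}

theorem lt_fracMax_iff {x : X} {a : ℝ≥0∞} :
    a < fracMax μ α g x ↔ ∃ (c : X) (r : ℝ), (0 < r ∧ x ∈ ball c r) ∧
      a < μ (ball c (5 * r)) ^ (α - 1) * ∫⁻ y in ball c r, g y ∂μ := by
  simp only [fracMax, lt_iSup_iff, exists_prop]

theorem le_fracMax {x c : X} {r : ℝ} (hr : 0 < r) (hx : x ∈ ball c r) :
    μ (ball c (5 * r)) ^ (α - 1) * ∫⁻ y in ball c r, g y ∂μ ≤ fracMax μ α g x :=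
  le_iSup_of_le c <| le_iSup_of_le r <| le_iSup_of_le ⟨hr, hx⟩ le_rfl

theorem fracMax_le {x : X} {a : ℝ≥0∞}
    (h : ∀ (c : X) (r : ℝ), 0 < r → x ∈ ball c r →
      μ (ball c (5 * r)) ^ (α - 1) * ∫⁻ y in ball c r, g y ∂μ ≤ a) :
    fracMax μ α g x ≤ a :=
  iSup_le fun c => iSup_le fun r => iSup_le fun hr => h c r hr.1 hr.2

theorem setOf_lt_fracMax (a : ℝ≥0∞) :
    {x | a < fracMax μ α g x} = ⋃ b ∈ {b : X × ℝ | 0 < b.2 ∧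
      a < μ (ball b.1 (5 * b.2)) ^ (α - 1) * ∫⁻ y in ball b.1 b.2, g y ∂μ}, ball b.1 b.2 := by
  ext x
  simp only [mem_ofPred_eq, lt_fracMax_iff, mem_iUnion, exists_prop, Prod.exists]
  exact exists_congr fun c => exists_congr fun r => by tauto

theorem measurable_fracMax [BorelSpace X] : Measurable (fracMax μ α g) := by
  refine measurable_of_Ioi fun a => IsOpen.measurableSet ?_
  change IsOpen {x | a < fracMax μ α g x}
  rw [setOf_lt_fracMax]
  exact isOpen_biUnion fun _ _ => isOpen_ball

theorem ENNReal.tsum_rpow_le_rpow_tsum {ι : Type*} (a : ι → ℝ≥0∞) {s : ℝ} (hs : 1 ≤ s) :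
    ∑' i, a i ^ s ≤ (∑' i, a i) ^ s := by
  have key (x : ℝ≥0∞) : x ^ s = x * x ^ (s - 1) := by
    have := ENNReal.rpow_add_of_nonneg (x := x) 1 (s - 1) zero_le_one (sub_nonneg.2 hs)
    rwa [add_sub_cancel, ENNReal.rpow_one] at this
  rw [key (∑' i, a i), ← ENNReal.tsum_mul_right]
  refine ENNReal.tsum_le_tsum fun i => ?_
  rw [key (a i)]
  gcongr
  exact ENNReal.le_tsum i

/-- Vitali covering estimate for a family of balls with bounded radii. -/
theorem measure_biUnion_ball_le_of_radius_le [OpensMeasurableSpace X]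
    [TopologicalSpace.SeparableSpace X] {h : X → ℝ≥0∞} {K : ℝ≥0∞} {s : ℝ} (hs : 1 ≤ s)
    {t : Set (X × ℝ)} (hpos : ∀ b ∈ t, 0 < b.2) {R : ℝ} (hR : ∀ b ∈ t, b.2 ≤ R)
    (ht : ∀ b ∈ t, μ (ball b.1 (5 * b.2)) ≤ K * (∫⁻ y in ball b.1 b.2, h y ∂μ) ^ s) :
    μ (⋃ b ∈ t, ball b.1 b.2) ≤ K * (∫⁻ y, h y ∂μ) ^ s := by
  obtain ⟨u, hut, hdisj, hu⟩ := Vitali.exists_disjoint_subfamily_covering_enlargement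
    (fun b : X × ℝ => ball b.1 b.2) t Prod.snd 2 one_lt_two (fun b hb => (hpos b hb).le) R hR
    (fun b hb => nonempty_ball.2 (hpos b hb))
  have hcount : u.Countable := hdisj.countable_of_isOpen (fun _ _ => isOpen_ball)
    (fun b hb => nonempty_ball.2 (hpos b (hut hb)))
  have hsub : (⋃ b ∈ t, ball b.1 b.2) ⊆ ⋃ b ∈ u, ball b.1 (5 * b.2) := by
    refine iUnion₂_subset fun a ha x hx => ?_
    obtain ⟨b, hb, ⟨z, hza, hzb⟩, hab⟩ := hu a ha
    refine mem_biUnion hb ?_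
    simp only [mem_ball] at *
    linarith [dist_triangle4 x a.1 z b.1, dist_comm a.1 z]
  calc μ (⋃ b ∈ t, ball b.1 b.2)
      ≤ μ (⋃ b ∈ u, ball b.1 (5 * b.2)) := measure_mono hsub
    _ ≤ ∑' b : u, μ (ball b.1.1 (5 * b.1.2)) := measure_biUnion_le μ hcount _
    _ ≤ ∑' b : u, K * (∫⁻ y in ball b.1.1 b.1.2, h y ∂μ) ^ s :=
        ENNReal.tsum_le_tsum fun b => ht b (hut b.2)
    _ = K * ∑' b : u, (∫⁻ y in ball b.1.1 b.1.2, h y ∂μ) ^ s := ENNReal.tsum_mul_left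
    _ ≤ K * (∑' b : u, ∫⁻ y in ball b.1.1 b.1.2, h y ∂μ) ^ s := by
        gcongr
        exact ENNReal.tsum_rpow_le_rpow_tsum _ hs
    _ = K * (∫⁻ y in ⋃ b ∈ u, ball b.1 b.2, h y ∂μ) ^ s := by
        rw [lintegral_biUnion hcount (fun _ _ => measurableSet_ball) hdisj]
    _ ≤ K * (∫⁻ y, h y ∂μ) ^ s := by
        gcongr
        exact Measure.restrict_le_self

theorem measure_biUnion_ball_le [OpensMeasurableSpace X]
    [TopologicalSpace.SeparableSpace X] {h : X → ℝ≥0∞} {K : ℝ≥0∞} {s : ℝ} (hs : 1 ≤ s)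
    {t : Set (X × ℝ)} (hpos : ∀ b ∈ t, 0 < b.2)
    (ht : ∀ b ∈ t, μ (ball b.1 (5 * b.2)) ≤ K * (∫⁻ y in ball b.1 b.2, h y ∂μ) ^ s) :
    μ (⋃ b ∈ t, ball b.1 b.2) ≤ K * (∫⁻ y, h y ∂μ) ^ s := by
  have hunion : (⋃ b ∈ t, ball b.1 b.2) =
      ⋃ N : ℕ, ⋃ b ∈ {b ∈ t | b.2 ≤ N}, ball b.1 b.2 := by
    refine subset_antisymm (iUnion₂_subset fun b hb => ?_)
      (iUnion_subset fun N => biUnion_subset_biUnion_left fun b hb => hb.1)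
    obtain ⟨N, hN⟩ := exists_nat_ge b.2
    exact subset_iUnion_of_subset N (subset_biUnion_of_mem (u := fun b : X × ℝ => ball b.1 b.2)
      (show b ∈ {b ∈ t | b.2 ≤ N} from ⟨hb, hN⟩))
  have hmono : Monotone fun N : ℕ => ⋃ b ∈ {b ∈ t | b.2 ≤ N}, ball b.1 b.2 := fun M N hMN =>
    biUnion_subset_biUnion_left fun b hb => ⟨hb.1, hb.2.trans (Nat.cast_le.2 hMN)⟩
  rw [hunion, hmono.measure_iUnion]
  exact iSup_le fun N => measure_biUnion_ball_le_of_radius_le hs (fun b hb => hpos b hb.1)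
    (fun b hb => hb.2) fun b hb => ht b hb.1

theorem setLIntegral_le_rpow_mul_measure_rpow {Y : Type*} [MeasurableSpace Y] {μ : Measure Y}
    {g : Y → ℝ≥0∞} {p : ℝ} (hp : 1 ≤ p) (hg : AEMeasurable g μ) (s : Set Y) :
    ∫⁻ y in s, g y ∂μ ≤ (∫⁻ y in s, g y ^ p ∂μ) ^ (1 / p) * μ s ^ (1 - 1 / p) := by
  simpa [eLpNorm'] using eLpNorm'_le_eLpNorm'_mul_rpow_measure_univ one_pos hp
    (hg.restrict (s := s)).aestronglyMeasurable

/-- Weak type `(p, q)` estimate for the fractional maximal function. -/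
theorem measure_lt_fracMax_le [OpensMeasurableSpace X] [TopologicalSpace.SeparableSpace X]
    (h0 : ∀ (c : X) (r : ℝ), 0 < r → μ (ball c r) ≠ 0) (htop : ∀ (c : X) (r : ℝ), μ (ball c r) ≠ ∞)
    {p q : ℝ} (hp : 1 ≤ p) (hpq : p ≤ q) (hq : 1 / q = 1 / p - α) (hg : AEMeasurable g μ)
    {a : ℝ≥0∞} (ha0 : a ≠ 0) (ha : a ≠ ∞) :
    μ {x | a < fracMax μ α g x} ≤ (a ^ q)⁻¹ * (∫⁻ x, g x ^ p ∂μ) ^ (q / p) := by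
  have hp0 : 0 < p := one_pos.trans_le hp
  have hq0 : 0 < q := hp0.trans_le hpq
  rw [setOf_lt_fracMax]
  refine measure_biUnion_ball_le ((one_le_div hp0).2 hpq) (fun b hb => hb.1) ?_
  rintro ⟨c, r⟩ ⟨hr, hb⟩
  dsimp only at hr hb ⊢
  have hr5 : 0 < 5 * r := by positivity
  set m := μ (ball c (5 * r))
  set G := ∫⁻ y in ball c r, g y ^ p ∂μ
  have hm0 : m ≠ 0 := h0 _ _ hr5
  have hmt : m ≠ ∞ := htop _ _
  have h1 : ∫⁻ y in ball c r, g y ∂μ ≤ G ^ (1 / p) * m ^ (1 - 1 / p) := by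
    refine (setLIntegral_le_rpow_mul_measure_rpow hp hg _).trans ?_
    gcongr
    · exact sub_nonneg.2 ((div_le_one hp0).2 hp)
    · exact measure_mono (ball_subset_ball (by linarith))
  have h2 : a * m ^ (1 / q) ≤ G ^ (1 / p) := by
    calc a * m ^ (1 / q) ≤ m ^ (α - 1) * (G ^ (1 / p) * m ^ (1 - 1 / p)) * m ^ (1 / q) := by
          gcongr
          exact hb.le.trans (by gcongr)
      _ = G ^ (1 / p) * (m ^ (α - 1) * m ^ (1 - 1 / p) * m ^ (1 / q)) := by ring
      _ = G ^ (1 / p) := by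
          rw [← ENNReal.rpow_add _ _ hm0 hmt, ← ENNReal.rpow_add _ _ hm0 hmt, hq]
          ring_nf
          simp
  have h3 : a ^ q * m ≤ G ^ (q / p) := by
    have := ENNReal.rpow_le_rpow h2 hq0.le
    rw [ENNReal.mul_rpow_of_nonneg _ _ hq0.le, ← ENNReal.rpow_mul, ← ENNReal.rpow_mul,
      one_div_mul_cancel hq0.ne', ENNReal.rpow_one, one_div_mul_eq_div] at this
    exact this
  have haq0 : a ^ q ≠ 0 := by simp [ENNReal.rpow_eq_zero_iff, ha0, ha]
  have haqt : a ^ q ≠ ∞ := ENNReal.rpow_ne_top_of_nonneg hq0.le ha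
  calc m = (a ^ q)⁻¹ * (a ^ q * m) := by
        rw [← mul_assoc, ENNReal.inv_mul_cancel haq0 haqt, one_mul]
    _ ≤ _ := by gcongr

/-- The weak type `(1, 1)` estimate, localized to the part of `g` above the level `a`. -/
theorem measure_two_mul_lt_fracMax_zero_le [BorelSpace X] [TopologicalSpace.SeparableSpace X]
    (h0 : ∀ (c : X) (r : ℝ), 0 < r → μ (ball c r) ≠ 0) (htop : ∀ (c : X) (r : ℝ), μ (ball c r) ≠ ∞)
    (hg : Measurable g) {a : ℝ≥0∞} (ha0 : a ≠ 0) (ha : a ≠ ∞) :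
    μ {x | a + a < fracMax μ 0 g x} ≤ a⁻¹ * ∫⁻ x in {x | a < g x}, g x ∂μ := by
  have hmeas : MeasurableSet {x | a < g x} := measurableSet_lt measurable_const hg
  set g' := {x | a < g x}.indicator g
  have hle (y : X) : g y ≤ g' y + a := by
    by_cases hy : y ∈ {x | a < g x}
    · simp [g', indicator_of_mem hy]
    · exact (not_lt.1 hy).trans le_add_self
  have hsub : {x | a + a < fracMax μ 0 g x} ⊆ {x | a < fracMax μ 0 g' x} := by
    intro x hx
    obtain ⟨c, r, ⟨hr, hxr⟩, hlt⟩ := lt_fracMax_iff.1 hx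
    refine lt_fracMax_iff.2 ⟨c, r, ⟨hr, hxr⟩, ?_⟩
    set m := μ (ball c (5 * r))
    have hm0 : m ≠ 0 := h0 _ _ (by positivity)
    have hmt : m ≠ ∞ := htop _ _
    have hmr : μ (ball c r) ≤ m := measure_mono (ball_subset_ball (by linarith))
    have h1 : m ^ (0 - 1 : ℝ) * ∫⁻ y in ball c r, g y ∂μ ≤
        m ^ (0 - 1 : ℝ) * ∫⁻ y in ball c r, g' y ∂μ + a := by
      calc m ^ (0 - 1 : ℝ) * ∫⁻ y in ball c r, g y ∂μ
          ≤ m ^ (0 - 1 : ℝ) * ∫⁻ y in ball c r, (g' y + a) ∂μ := by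
            gcongr with y
            exact hle y
        _ = m ^ (0 - 1 : ℝ) * ∫⁻ y in ball c r, g' y ∂μ + m⁻¹ * μ (ball c r) * a := by
            rw [lintegral_add_right _ measurable_const, setLIntegral_const, mul_add, zero_sub,
              ENNReal.rpow_neg_one]
            ring
        _ ≤ m ^ (0 - 1 : ℝ) * ∫⁻ y in ball c r, g' y ∂μ + m⁻¹ * m * a := by gcongr
        _ = _ := by rw [ENNReal.inv_mul_cancel hm0 hmt, one_mul]
    exact lt_of_add_lt_add_right (hlt.trans_le h1)
  refine (measure_mono hsub).trans ?_
  refine (measure_lt_fracMax_le h0 htop le_rfl le_rfl (by norm_num)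
    (hg.indicator hmeas).aemeasurable ha0 ha).trans_eq ?_
  simp [lintegral_indicator hmeas]

theorem fracMax_zero_ne_top_ae [BorelSpace X] [TopologicalSpace.SeparableSpace X]
    (h0 : ∀ (c : X) (r : ℝ), 0 < r → μ (ball c r) ≠ 0) (htop : ∀ (c : X) (r : ℝ), μ (ball c r) ≠ ∞)
    {p : ℝ} (hp : 1 ≤ p) (hg : AEMeasurable g μ) (hgp : ∫⁻ x, g x ^ p ∂μ ≠ ∞) :
    ∀ᵐ x ∂μ, fracMax μ 0 g x ≠ ∞ := by
  have hp0 : 0 < p := one_pos.trans_le hp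
  rw [ae_iff]
  by_contra hne
  obtain ⟨N, hN⟩ := ENNReal.exists_nat_mul_gt hne hgp
  have hN0 : (N : ℝ≥0∞) ≠ 0 := by
    rintro h
    simp [h] at hN
  set a : ℝ≥0∞ := (N : ℝ≥0∞) ^ (1 / p) with ha_def
  have hap : a ^ p = N := by
    rw [ha_def, ← ENNReal.rpow_mul, one_div_mul_cancel hp0.ne', ENNReal.rpow_one]
  have ha : a ≠ ∞ := ENNReal.rpow_ne_top_of_nonneg (by positivity) (ENNReal.natCast_ne_top N)
  have ha0 : a ≠ 0 := by
    rintro h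
    rw [h, ENNReal.zero_rpow_of_pos hp0] at hap
    exact hN0 hap.symm
  have h1 : μ {x | ¬ fracMax μ 0 g x ≠ ∞} ≤ (N : ℝ≥0∞)⁻¹ * ∫⁻ x, g x ^ p ∂μ := by
    refine (measure_mono fun x hx => ?_).trans
      ((measure_lt_fracMax_le (α := 0) h0 htop hp le_rfl (by ring) hg ha0 ha).trans_eq ?_)
    · rw [mem_ofPred_eq, not_not] at hx
      rw [mem_ofPred_eq, hx]
      exact ha.lt_top
    · rw [hap, div_self hp0.ne', ENNReal.rpow_one]
  refine hN.not_ge ?_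
  calc (N : ℝ≥0∞) * μ {x | ¬ fracMax μ 0 g x ≠ ∞}
      ≤ N * ((N : ℝ≥0∞)⁻¹ * ∫⁻ x, g x ^ p ∂μ) := by gcongr
    _ = _ := by
      rw [← mul_assoc, ENNReal.mul_inv_cancel hN0 (ENNReal.natCast_ne_top N), one_mul]

/-- Strong type `(p, p)` estimate for `fracMax μ 0`. -/
theorem lintegral_fracMax_zero_rpow_le [BorelSpace X] [TopologicalSpace.SeparableSpace X]
    (h0 : ∀ (c : X) (r : ℝ), 0 < r → μ (ball c r) ≠ 0) (htop : ∀ (c : X) (r : ℝ), μ (ball c r) ≠ ∞)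
    {p : ℝ} (hp : 1 < p) {f : X → ℝ} (hf : Measurable f) (hf0 : ∀ x, 0 ≤ f x)
    (hfp : ∫⁻ x, ENNReal.ofReal (f x) ^ p ∂μ ≠ ∞) :
    ∫⁻ x, fracMax μ 0 (fun y => ENNReal.ofReal (f y)) x ^ p ∂μ ≤
      ENNReal.ofReal (p * (p - 1)⁻¹ * 2 ^ p) * ∫⁻ x, ENNReal.ofReal (f x) ^ p ∂μ := by
  have hp0 : 0 < p := one_pos.trans hp
  have hp1 : 0 < p - 1 := sub_pos.2 hp
  set g : X → ℝ≥0∞ := fun y => ENNReal.ofReal (f y) with hg_def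
  have hg : Measurable g := hf.ennreal_ofReal
  set F := fracMax μ 0 g
  have hF : Measurable F := measurable_fracMax
  set ν := μ.withDensity g
  have hlevel : ∀ t ∈ Ioi (0 : ℝ), μ {x | t < (F x).toReal} * ENNReal.ofReal (t ^ (p - 1)) ≤
      2 * (ν {x | t < 2 * f x} * ENNReal.ofReal (t ^ (p - 1 - 1))) := by
    intro t (ht : 0 < t)
    have ht2 : 0 < t / 2 := by positivity
    have hset : {x | ENNReal.ofReal (t / 2) < g x} = {x | t < 2 * f x} := by
      ext x
      simp only [mem_ofPred_eq, hg_def, ENNReal.ofReal_lt_ofReal_iff_of_nonneg ht2.le]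
      constructor <;> intro h <;> linarith
    have h1 : μ {x | t < (F x).toReal} ≤
        (ENNReal.ofReal (t / 2))⁻¹ * ν {x | t < 2 * f x} := by
      refine (measure_mono fun x hx => ?_).trans ((measure_two_mul_lt_fracMax_zero_le h0 htop hg
        (ENNReal.ofReal_pos.2 ht2).ne' ENNReal.ofReal_ne_top).trans_eq ?_)
      · rw [mem_ofPred_eq, ← ENNReal.ofReal_add ht2.le ht2.le, add_halves]
        exact (ENNReal.ofReal_lt_iff_lt_toReal ht.le fun h => by
          simp only [mem_ofPred_eq, show F x = ∞ from h, ENNReal.toReal_top] at hx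
          linarith).2 hx
      · rw [hset, withDensity_apply _ (measurableSet_lt measurable_const (hf.const_mul 2))]
    have h2 : (ENNReal.ofReal (t / 2))⁻¹ * ENNReal.ofReal (t ^ (p - 1)) =
        2 * ENNReal.ofReal (t ^ (p - 1 - 1)) := by
      rw [← ENNReal.ofReal_inv_of_pos ht2, ← ENNReal.ofReal_mul (by positivity),
        show (2 : ℝ≥0∞) = ENNReal.ofReal 2 by simp, ← ENNReal.ofReal_mul (by positivity),
        Real.rpow_sub_one ht.ne' (p - 1)]
      congr 1
      field_simp
    calc μ {x | t < (F x).toReal} * ENNReal.ofReal (t ^ (p - 1))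
        ≤ (ENNReal.ofReal (t / 2))⁻¹ * ν {x | t < 2 * f x} * ENNReal.ofReal (t ^ (p - 1)) := by
          gcongr
      _ = ν {x | t < 2 * f x} *
          ((ENNReal.ofReal (t / 2))⁻¹ * ENNReal.ofReal (t ^ (p - 1))) := by ring
      _ = _ := by rw [h2]; ring
  have hFae : ∫⁻ x, F x ^ p ∂μ = ∫⁻ x, ENNReal.ofReal ((F x).toReal ^ p) ∂μ := by
    refine lintegral_congr_ae ?_
    filter_upwards [fracMax_zero_ne_top_ae h0 htop hp.le hg.aemeasurable hfp] with x hx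
    rw [← ENNReal.ofReal_rpow_of_nonneg ENNReal.toReal_nonneg hp0.le, ENNReal.ofReal_toReal hx]
  have hν : ∫⁻ x, ENNReal.ofReal ((2 * f x) ^ (p - 1)) ∂ν =
      ENNReal.ofReal (2 ^ (p - 1)) * ∫⁻ x, g x ^ p ∂μ := by
    rw [lintegral_withDensity_eq_lintegral_mul _ hg (by fun_prop),
      ← lintegral_const_mul _ (by fun_prop)]
    refine lintegral_congr fun x => ?_
    have hx := hf0 x
    simp only [Pi.mul_apply, hg_def]
    rw [ENNReal.ofReal_rpow_of_nonneg hx hp0.le, ← ENNReal.ofReal_mul hx,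
      ← ENNReal.ofReal_mul (by positivity), Real.mul_rpow zero_le_two hx]
    congr 1
    rw [mul_left_comm]
    congr 1
    rcases hx.eq_or_lt with h | h
    · rw [← h, Real.zero_rpow hp0.ne', zero_mul]
    · rw [Real.rpow_sub_one h.ne']
      field_simp
  rw [hFae, lintegral_rpow_eq_lintegral_meas_lt_mul μ
    (Filter.Eventually.of_forall fun x => ENNReal.toReal_nonneg) hF.ennreal_toReal.aemeasurable hp0]
  have hlayer := lintegral_rpow_eq_lintegral_meas_lt_mul ν (f := fun x => 2 * f x)
    (Filter.Eventually.of_forall fun x => mul_nonneg zero_le_two (hf0 x))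
    (hf.const_mul 2).aemeasurable hp1
  rw [hν] at hlayer
  set J := ∫⁻ t in Ioi (0 : ℝ), ν {x | t < 2 * f x} * ENNReal.ofReal (t ^ (p - 1 - 1))
  have hJ : J = ENNReal.ofReal ((p - 1)⁻¹ * 2 ^ (p - 1)) * ∫⁻ x, g x ^ p ∂μ := by
    rw [ENNReal.ofReal_mul (by positivity), mul_assoc, hlayer, ← mul_assoc,
      ← ENNReal.ofReal_mul (by positivity), inv_mul_cancel₀ hp1.ne', ENNReal.ofReal_one, one_mul]
  calc ENNReal.ofReal p * ∫⁻ t in Ioi (0 : ℝ),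
        μ {x | t < (F x).toReal} * ENNReal.ofReal (t ^ (p - 1))
      ≤ ENNReal.ofReal p * ∫⁻ t in Ioi (0 : ℝ),
        2 * (ν {x | t < 2 * f x} * ENNReal.ofReal (t ^ (p - 1 - 1))) := by
        gcongr 1
        exact setLIntegral_mono' measurableSet_Ioi hlevel
    _ = ENNReal.ofReal p * (ENNReal.ofReal 2 * J) := by
        rw [lintegral_const_mul' _ _ (by simp)]
        simp [J]
    _ = _ := by
        rw [hJ, ← mul_assoc, ← mul_assoc, ← ENNReal.ofReal_mul (by positivity),
          ← ENNReal.ofReal_mul (by positivity), Real.rpow_sub_one two_ne_zero]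
        congr 2
        field_simp

/-- Pointwise interpolation between `fracMax μ 0` and the `L^p` norm. -/
theorem fracMax_le_mul_fracMax_zero_rpow
    (h0 : ∀ (c : X) (r : ℝ), 0 < r → μ (ball c r) ≠ 0) (htop : ∀ (c : X) (r : ℝ), μ (ball c r) ≠ ∞)
    {p q : ℝ} (hp : 1 ≤ p) (hpq : p ≤ q) (hq : 1 / q = 1 / p - α) (hg : AEMeasurable g μ) (x : X) :
    fracMax μ α g x ≤
      (∫⁻ x, g x ^ p ∂μ) ^ ((1 / p) * (1 - p / q)) * fracMax μ 0 g x ^ (p / q) := by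
  have hp0 : 0 < p := one_pos.trans_le hp
  have hq0 : 0 < q := hp0.trans_le hpq
  have hθ0 : 0 ≤ p / q := by positivity
  have hθ1 : 0 ≤ 1 - p / q := sub_nonneg.2 ((div_le_one hq0).2 hpq)
  refine fracMax_le fun c r hr hx => ?_
  set A := ∫⁻ x, g x ^ p ∂μ
  set m := μ (ball c (5 * r))
  set I := ∫⁻ y in ball c r, g y ∂μ
  have hm0 : m ≠ 0 := h0 _ _ (by positivity)
  have hmt : m ≠ ∞ := htop _ _
  have hI : I ≤ A ^ (1 / p) * m ^ (1 - 1 / p) := by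
    refine (setLIntegral_le_rpow_mul_measure_rpow hp hg _).trans ?_
    gcongr
    · exact setLIntegral_le_lintegral _ _
    · exact sub_nonneg.2 ((div_le_one hp0).2 hp)
    · exact measure_mono (ball_subset_ball (by linarith))
  have hexp : α - 1 + (1 - 1 / p) * (1 - p / q) = (0 - 1) * (p / q) := by
    have hα : α = 1 / p - 1 / q := by linarith
    rw [hα]
    field_simp
    ring
  calc m ^ (α - 1) * I = m ^ (α - 1) * (I ^ (1 - p / q) * I ^ (p / q)) := by
        rw [← ENNReal.rpow_add_of_nonneg _ _ hθ1 hθ0, sub_add_cancel, ENNReal.rpow_one]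
    _ ≤ m ^ (α - 1) * ((A ^ (1 / p) * m ^ (1 - 1 / p)) ^ (1 - p / q) * I ^ (p / q)) := by
        gcongr
    _ = A ^ ((1 / p) * (1 - p / q)) *
        ((m ^ (α - 1) * m ^ ((1 - 1 / p) * (1 - p / q))) * I ^ (p / q)) := by
        rw [ENNReal.mul_rpow_of_nonneg _ _ hθ1, ← ENNReal.rpow_mul, ← ENNReal.rpow_mul]
        ring
    _ = A ^ ((1 / p) * (1 - p / q)) * (m ^ (0 - 1 : ℝ) * I) ^ (p / q) := by
        rw [← ENNReal.rpow_add _ _ hm0 hmt, hexp,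
          ENNReal.mul_rpow_of_nonneg _ _ hθ0, ← ENNReal.rpow_mul m]
    _ ≤ _ := by
        gcongr
        exact le_fracMax hr hx

/-- Strong type `(p, q)` estimate for the fractional maximal function. -/
theorem lintegral_fracMax_rpow_le [BorelSpace X] [TopologicalSpace.SeparableSpace X]
    (h0 : ∀ (c : X) (r : ℝ), 0 < r → μ (ball c r) ≠ 0) (htop : ∀ (c : X) (r : ℝ), μ (ball c r) ≠ ∞)
    {p q : ℝ} (hp : 1 < p) (hpq : p ≤ q) (hq : 1 / q = 1 / p - α)
    {f : X → ℝ} (hf : Measurable f) (hf0 : ∀ x, 0 ≤ f x)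
    (hfp : ∫⁻ x, ENNReal.ofReal (f x) ^ p ∂μ ≠ ∞) :
    (∫⁻ x, fracMax μ α (fun y => ENNReal.ofReal (f y)) x ^ q ∂μ) ^ (1 / q) ≤
      ENNReal.ofReal (p * (p - 1)⁻¹ * 2 ^ p) ^ (1 / q) *
        (∫⁻ x, ENNReal.ofReal (f x) ^ p ∂μ) ^ (1 / p) := by
  have hp0 : 0 < p := one_pos.trans hp
  have hq0 : 0 < q := hp0.trans_le hpq
  have hθ1 : 0 ≤ 1 - p / q := sub_nonneg.2 ((div_le_one hq0).2 hpq)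
  have hg : Measurable fun y => ENNReal.ofReal (f y) := hf.ennreal_ofReal
  set A := ∫⁻ x, ENNReal.ofReal (f x) ^ p ∂μ
  set C := ENNReal.ofReal (p * (p - 1)⁻¹ * 2 ^ p)
  have hmain : ∫⁻ x, fracMax μ α (fun y => ENNReal.ofReal (f y)) x ^ q ∂μ ≤
      (A ^ ((1 / p) * (1 - p / q))) ^ q * (C * A) := by
    calc ∫⁻ x, fracMax μ α (fun y => ENNReal.ofReal (f y)) x ^ q ∂μ
        ≤ ∫⁻ x, (A ^ ((1 / p) * (1 - p / q))) ^ q *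
          fracMax μ 0 (fun y => ENNReal.ofReal (f y)) x ^ p ∂μ := by
          refine lintegral_mono fun x => ?_
          refine (ENNReal.rpow_le_rpow (fracMax_le_mul_fracMax_zero_rpow h0 htop hp.le hpq hq
            hg.aemeasurable x) hq0.le).trans_eq ?_
          rw [ENNReal.mul_rpow_of_nonneg _ _ hq0.le, ← ENNReal.rpow_mul _ (p / q),
            div_mul_cancel₀ _ hq0.ne']
      _ = (A ^ ((1 / p) * (1 - p / q))) ^ q *
          ∫⁻ x, fracMax μ 0 (fun y => ENNReal.ofReal (f y)) x ^ p ∂μ :=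
          lintegral_const_mul _ (measurable_fracMax.pow_const p)
      _ ≤ _ := by
          gcongr
          exact lintegral_fracMax_zero_rpow_le h0 htop hp hf hf0 hfp
  refine (ENNReal.rpow_le_rpow hmain (one_div_nonneg.2 hq0.le)).trans_eq ?_
  rw [ENNReal.mul_rpow_of_nonneg _ _ (one_div_nonneg.2 hq0.le),
    ENNReal.mul_rpow_of_nonneg _ _ (one_div_nonneg.2 hq0.le), ← ENNReal.rpow_mul _ q,
    mul_one_div_cancel hq0.ne', ENNReal.rpow_one, mul_left_comm,
    ← ENNReal.rpow_add_of_nonneg _ _ (by positivity) (by positivity)]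
  congr 2
  field_simp
  ring

end FractionalMaximal

section Weight

variable {n : ℕ} {w : Euc n → ℝ}

theorem aemeasurable_ofReal_of_isWeight (hw : IsWeight w) :
    AEMeasurable (fun x => ENNReal.ofReal (w x)) volume :=
  hw.2.aestronglyMeasurable.aemeasurable.ennreal_ofReal

theorem withDensity_ball_ne_zero (hw : IsWeight w) (c : Euc n) {r : ℝ} (hr : 0 < r) :
    volume.withDensity (fun x => ENNReal.ofReal (w x)) (ball c r) ≠ 0 := fun h =>
  (measure_ball_pos volume c hr).ne' <|
    withDensity_absolutelyContinuous' (aemeasurable_ofReal_of_isWeight hw)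
      (Filter.Eventually.of_forall fun x => (ENNReal.ofReal_pos.2 (hw.1 x)).ne') h

theorem withDensity_ball_ne_top (hw : IsWeight w) (c : Euc n) (r : ℝ) :
    volume.withDensity (fun x => ENNReal.ofReal (w x)) (ball c r) ≠ ∞ := by
  rw [withDensity_apply _ measurableSet_ball]
  have hint : IntegrableOn w (ball c r) :=
    (hw.2.integrableOn_isCompact (isCompact_closedBall c r)).mono_set ball_subset_closedBall
  exact ((hasFiniteIntegral_iff_ofReal
    (Filter.Eventually.of_forall fun x => (hw.1 x).le)).1 hint.2).ne

theorem eMaxW_eq_fracMax (hw : IsWeight w) (β : ℝ) {f : Euc n → ℝ} (hf : Measurable f) :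
    eMaxW w β f = fracMax (volume.withDensity fun x => ENNReal.ofReal (w x)) (β / n)
      fun y => ENNReal.ofReal |f y| := by
  ext x
  simp only [eMaxW, fracMax, wSet, withDensity_apply']
  refine iSup_congr fun c => iSup_congr fun r => iSup_congr fun _ => ?_
  congr 1
  rw [restrict_withDensity measurableSet_ball, lintegral_withDensity_eq_lintegral_mul₀
    (aemeasurable_ofReal_of_isWeight hw).restrict (by fun_prop)]
  refine lintegral_congr fun y => ?_
  rw [Pi.mul_apply, ENNReal.ofReal_mul (abs_nonneg _), mul_comm]

theorem lintegral_abs_rpow_withDensity (hw : IsWeight w) {p : ℝ} (hp : 0 ≤ p) {f : Euc n → ℝ}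
    (hf : Measurable f) (hfp : Integrable (fun x => |f x| ^ p * w x) volume) :
    ∫⁻ x, ENNReal.ofReal |f x| ^ p ∂volume.withDensity (fun x => ENNReal.ofReal (w x)) =
      ENNReal.ofReal (∫ x, |f x| ^ p * w x) := by
  rw [lintegral_withDensity_eq_lintegral_mul₀ (aemeasurable_ofReal_of_isWeight hw) (by fun_prop),
    ofReal_integral_eq_lintegral_ofReal hfp (Filter.Eventually.of_forall fun x =>
      mul_nonneg (Real.rpow_nonneg (abs_nonneg _) _) (hw.1 x).le)]
  refine lintegral_congr fun x => ?_
  rw [Pi.mul_apply, ENNReal.ofReal_rpow_of_nonneg (abs_nonneg _) hp,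
    ENNReal.ofReal_mul (Real.rpow_nonneg (abs_nonneg _) _), mul_comm]

end Weight

/-- Lemma 2.5. -/
theorem stmt7 (n : ℕ) (hn : 0 < n) (β p q : ℝ) (hβ0 : 0 ≤ β) (hβn : β < n)
    (hp : 1 ≤ p) (hpn : p * β < n) (hq : 1 / q = 1 / p - β / n)
    (w : Euc n → ℝ) (hw : IsWeight w) :
    ∃ C : ℝ, 0 < C ∧
      (∀ f : Euc n → ℝ, Measurable f → Integrable (fun x => |f x| ^ p * w x) volume →
        ∀ lam : ℝ, 0 < lam →
          wSet w {x : Euc n | ENNReal.ofReal lam < eMaxW w β f x} ≤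
            ENNReal.ofReal (C * ((∫ x, |f x| ^ p * w x) ^ (1 / p) / lam) ^ q)) ∧
      (1 < p → ∃ C' : ℝ, 0 < C' ∧
        ∀ f : Euc n → ℝ, Measurable f → Integrable (fun x => |f x| ^ p * w x) volume →
          (∫⁻ x, eMaxW w β f x ^ q * ENNReal.ofReal (w x)) ^ (1 / q) ≤
            ENNReal.ofReal (C' * (∫ x, |f x| ^ p * w x) ^ (1 / p))) := by
  have hn' : (0 : ℝ) < n := Nat.cast_pos.2 hn
  have hp0 : 0 < p := one_pos.trans_le hp
  have hq_pos : 0 < 1 / q := by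
    rw [hq, sub_pos, div_lt_div_iff₀ hn' hp0]
    linarith
  have hq0 : 0 < q := one_div_pos.1 hq_pos
  have hpq : p ≤ q := by
    refine (one_div_le_one_div hq0 hp0).1 ?_
    rw [hq]
    linarith [div_nonneg hβ0 hn'.le]
  set μ : Measure (Euc n) := volume.withDensity fun x => ENNReal.ofReal (w x) with hμ
  have h0 : ∀ (c : Euc n) (r : ℝ), 0 < r → μ (ball c r) ≠ 0 :=
    fun c r => withDensity_ball_ne_zero hw c
  have htop : ∀ (c : Euc n) (r : ℝ), μ (ball c r) ≠ ∞ := withDensity_ball_ne_top hw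
  have hA (f : Euc n → ℝ) : 0 ≤ ∫ x, |f x| ^ p * w x :=
    integral_nonneg fun x => mul_nonneg (Real.rpow_nonneg (abs_nonneg _) _) (hw.1 x).le
  refine ⟨1, one_pos, fun f hf hfp lam hlam => ?_, fun hp1 => ?_⟩
  · have hA := hA f
    rw [wSet, ← withDensity_apply', eMaxW_eq_fracMax hw β hf]
    refine (measure_lt_fracMax_le h0 htop hp hpq hq hf.abs.ennreal_ofReal.aemeasurable
      (ENNReal.ofReal_pos.2 hlam).ne' ENNReal.ofReal_ne_top).trans_eq ?_
    rw [lintegral_abs_rpow_withDensity hw hp0.le hf hfp, one_mul,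
      Real.div_rpow (by positivity) hlam.le, ← Real.rpow_mul hA, one_div_mul_eq_div,
      ENNReal.ofReal_rpow_of_nonneg hA (by positivity),
      ENNReal.ofReal_rpow_of_nonneg hlam.le hq0.le, ENNReal.ofReal_div_of_pos (by positivity),
      ENNReal.div_eq_inv_mul]
  · have hp1' : 0 < p - 1 := sub_pos.2 hp1
    refine ⟨(p * (p - 1)⁻¹ * 2 ^ p) ^ (1 / q), by positivity, fun f hf hfp => ?_⟩
    have hA := hA f
    have hlint := lintegral_abs_rpow_withDensity hw hp0.le hf hfp
    have h := lintegral_fracMax_rpow_le h0 htop hp1 hpq hq hf.abs (fun x => abs_nonneg _)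
      (hlint ▸ ENNReal.ofReal_ne_top)
    rw [← eMaxW_eq_fracMax hw β hf, hlint, hμ, lintegral_withDensity_eq_lintegral_mul₀
      (aemeasurable_ofReal_of_isWeight hw)
      (by rw [eMaxW_eq_fracMax hw β hf]; exact (measurable_fracMax.pow_const q).aemeasurable),
      ENNReal.ofReal_rpow_of_nonneg (by positivity) (by positivity),
      ENNReal.ofReal_rpow_of_nonneg hA (by positivity), ← ENNReal.ofReal_mul (by positivity)] at h
    simpa only [Pi.mul_apply, mul_comm] using h
end
end
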